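/- There is a constant C > 0, independent of T, ψ and v, with the following property. Let ψ : [0,T]×ℝ³ → ℝ and v : [0,T]×ℝ³ → ℝ³ be smooth, Schwartz in the space variable for each t, with div v = 0 and satisfying the transport equation ∂_tψ + v·∇ψ + v₃ = 0 on [0,T]×ℝ³. Then |∫₀^T∫_{ℝ³} ∂₃v₃ · (∂₃³ψ)² dx dt| ≤ C B_T³ (1 + B_T²). -/

import Mathlib

open MeasureTheory Real Set Filter
open scoped ENNReal NNReal

noncomputable section

/-- Spatial points of `ℝ³`. -/
abbrev Pt : Type := Fin 3 → ℝ

/-- Partial derivative in the `i`-th coordinate direction. -/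
def pd (i : Fin 3) (f : Pt → ℝ) : Pt → ℝ := fun x => fderiv ℝ f x (Pi.single i 1)

/-- Iterated partial derivative `∂^α` for a multi-index `α`. -/
def pdM (α : Fin 3 → ℕ) (f : Pt → ℝ) : Pt → ℝ :=
  (pd 0)^[α 0] ((pd 1)^[α 1] ((pd 2)^[α 2] f))

/-- Multi-indices of total degree at most `k`. -/
def midx (k : ℕ) : Finset (Fin 3 → ℕ) :=
  (Fintype.piFinset fun _ => Finset.range (k + 1)).filter fun α => ∑ i, α i ≤ k

/-- The `H^k` inner product `(f|g)_{H^k} = ∑_{|α| ≤ k} ∫ ∂^α f ∂^α g`. -/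
def hInner (k : ℕ) (f g : Pt → ℝ) : ℝ := ∑ α ∈ midx k, ∫ x : Pt, pdM α f x * pdM α g x

/-- The squared `H^k` norm. -/
def hSq (k : ℕ) (f : Pt → ℝ) : ℝ := hInner k f f

/-- The squared `L²` norm. -/
def l2Sq (f : Pt → ℝ) : ℝ := ∫ x : Pt, (f x) ^ 2

/-- The Laplacian. -/
def lapl (f : Pt → ℝ) : Pt → ℝ := fun x => ∑ i, pd i (pd i f) x

/-- Horizontal directions. -/
def hIdx : Finset (Fin 3) := {0, 1}

/-- `L^∞` norm in time over `[0,T]` of a (nonnegative) function of time. -/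
def supT (T : ℝ) (g : ℝ → ℝ) : ℝ := sSup (g '' Icc 0 T)

/-- `L²` norm in time over `[0,T]`. -/
def l2T (T : ℝ) (g : ℝ → ℝ) : ℝ := Real.sqrt (∫ t in (0:ℝ)..T, (g t) ^ 2)

/-- `L⁴` norm in time over `[0,T]`. -/
def l4T (T : ℝ) (g : ℝ → ℝ) : ℝ := (∫ t in (0:ℝ)..T, (g t) ^ 4) ^ ((1:ℝ)/4)

/-- A function is Schwartz: smooth with all derivatives rapidly decaying. -/
def IsSchwartz (f : Pt → ℝ) : Prop :=
  ContDiff ℝ (⊤ : ℕ∞) f ∧ ∀ k n : ℕ, ∃ C : ℝ, ∀ x, ‖x‖ ^ k * ‖iteratedFDeriv ℝ n f x‖ ≤ C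

/-- Smoothness of `f` jointly in `(t,x)` on `s ×ˢ ℝ³`. -/
def SmoothOn2 (s : Set ℝ) (f : ℝ → Pt → ℝ) : Prop :=
  ContDiffOn ℝ (⊤ : ℕ∞) (fun q : ℝ × Pt => f q.1 q.2) (s ×ˢ (univ : Set Pt))

/-- `‖∇f‖_{H^k}²`. -/
def gradHSq (k : ℕ) (f : Pt → ℝ) : ℝ := ∑ i, hSq k (pd i f)

/-- `‖∇_h∇f‖_{H^k}²`. -/
def gradHHSq (k : ℕ) (f : Pt → ℝ) : ℝ := ∑ i ∈ hIdx, ∑ j, hSq k (pd i (pd j f))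

/-- `‖v‖_{H^k}²` for a vector field. -/
def vecHSq (k : ℕ) (v : Fin 3 → Pt → ℝ) : ℝ := ∑ j, hSq k (v j)

/-- `‖∇v‖_{H^k}²` for a vector field. -/
def gradVecHSq (k : ℕ) (v : Fin 3 → Pt → ℝ) : ℝ := ∑ j, gradHSq k (v j)

/-- `B_T²`. -/
def BTsq (T : ℝ) (ψ : ℝ → Pt → ℝ) (v : Fin 3 → ℝ → Pt → ℝ) : ℝ :=
  (supT T fun t => Real.sqrt (vecHSq 2 fun j => v j t)) ^ 2
  + (supT T fun t => Real.sqrt (gradHSq 2 (ψ t))) ^ 2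
  + (l2T T fun t => Real.sqrt (gradVecHSq 2 fun j => v j t)) ^ 2
  + (l2T T fun t => Real.sqrt (gradHHSq 1 (ψ t))) ^ 2

/-- `B_T`. -/
def BT (T : ℝ) (ψ : ℝ → Pt → ℝ) (v : Fin 3 → ℝ → Pt → ℝ) : ℝ := Real.sqrt (BTsq T ψ v)

/-- The transport equation `∂_tψ + v·∇ψ + v₃ = 0` on `s × ℝ³`. -/
def TransportEq (s : Set ℝ) (ψ : ℝ → Pt → ℝ) (v : Fin 3 → ℝ → Pt → ℝ) : Prop :=
  ∀ t ∈ s, ∀ x, deriv (fun τ => ψ τ x) t + (∑ i, v i t x * pd i (ψ t) x) + v 2 t x = 0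

/-- Divergence-free condition on `s × ℝ³`. -/
def DivFree (s : Set ℝ) (v : Fin 3 → ℝ → Pt → ℝ) : Prop :=
  ∀ t ∈ s, ∀ x, (∑ i, pd i (fun y => v i t y) x) = 0

/-- The momentum equations of system (S) on `s × ℝ³`. -/
def MomentumEq (s : Set ℝ) (ψ : ℝ → Pt → ℝ) (v : Fin 3 → ℝ → Pt → ℝ)
    (p : ℝ → Pt → ℝ) : Prop :=
  ∀ j : Fin 3, ∀ t ∈ s, ∀ x,
    deriv (fun τ => v j τ x) t + (∑ i, v i t x * pd i (v j t) x) - lapl (v j t) x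
      + pd j (p t) x + pd j (pd 2 (ψ t)) x + (if j = 2 then lapl (ψ t) x else 0)
    = - ∑ i, pd i (fun y => pd j (ψ t) y * pd i (ψ t) y) x

/-- The full system (S) on `s × ℝ³`. -/
def SolvesS (s : Set ℝ) (ψ : ℝ → Pt → ℝ) (v : Fin 3 → ℝ → Pt → ℝ)
    (p : ℝ → Pt → ℝ) : Prop :=
  TransportEq s ψ v ∧ MomentumEq s ψ v p ∧ DivFree s v

/-- Finiteness of the four norms entering `B_T`. -/
def FiniteClass (T : ℝ) (ψ : ℝ → Pt → ℝ) (v : Fin 3 → ℝ → Pt → ℝ) : Prop :=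
  BddAbove ((fun t => Real.sqrt (vecHSq 2 fun j => v j t)) '' Icc 0 T) ∧
  BddAbove ((fun t => Real.sqrt (gradHSq 2 (ψ t))) '' Icc 0 T) ∧
  IntervalIntegrable (fun t => gradVecHSq 2 fun j => v j t) volume 0 T ∧
  IntervalIntegrable (fun t => gradHHSq 1 (ψ t)) volume 0 T

open SchwartzMap in
lemma IsSchwartz.exists_schwartzMap {f : Pt → ℝ} (hf : IsSchwartz f) :
    ∃ F : 𝓢(Pt, ℝ), ⇑F = f :=
  ⟨⟨f, hf.1, hf.2⟩, rfl⟩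

lemma isSchwartz_schwartzMap (F : SchwartzMap Pt ℝ) : IsSchwartz F :=
  ⟨F.smooth', F.decay'⟩

lemma IsSchwartz.pd {f : Pt → ℝ} (hf : IsSchwartz f) (i : Fin 3) : IsSchwartz (pd i f) := by
  obtain ⟨F, rfl⟩ := hf.exists_schwartzMap
  convert isSchwartz_schwartzMap (LineDeriv.lineDerivOp (Pi.single i 1 : Pt) F) using 1
  funext x
  exact (SchwartzMap.lineDerivOp_apply_eq_fderiv _ F x).symm

lemma IsSchwartz.integrable {f : Pt → ℝ} (hf : IsSchwartz f) : Integrable f := by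
  obtain ⟨F, rfl⟩ := hf.exists_schwartzMap
  exact F.integrable

lemma IsSchwartz.memLp {f : Pt → ℝ} (hf : IsSchwartz f) (p : ℝ≥0∞) : MemLp f p := by
  obtain ⟨F, rfl⟩ := hf.exists_schwartzMap
  exact F.memLp p

lemma IsSchwartz.continuous {f : Pt → ℝ} (hf : IsSchwartz f) : Continuous f := hf.1.continuous

lemma IsSchwartz.differentiable {f : Pt → ℝ} (hf : IsSchwartz f) : Differentiable ℝ f :=
  hf.1.differentiable (by simp)

lemma IsSchwartz.bounded {f : Pt → ℝ} (hf : IsSchwartz f) : ∃ C, ∀ x, |f x| ≤ C := by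
  obtain ⟨C, hC⟩ := hf.2 0 0
  exact ⟨C, fun x => by simpa using hC x⟩

lemma IsSchwartz.mul {f g : Pt → ℝ} (hf : IsSchwartz f) (hg : IsSchwartz g) :
    IsSchwartz (fun x => f x * g x) := by
  obtain ⟨F, rfl⟩ := hf.exists_schwartzMap
  obtain ⟨G, rfl⟩ := hg.exists_schwartzMap
  exact isSchwartz_schwartzMap (SchwartzMap.pairing (ContinuousLinearMap.mul ℝ ℝ) F G)

lemma IsSchwartz.add {f g : Pt → ℝ} (hf : IsSchwartz f) (hg : IsSchwartz g) :
    IsSchwartz (fun x => f x + g x) := by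
  obtain ⟨F, rfl⟩ := hf.exists_schwartzMap
  obtain ⟨G, rfl⟩ := hg.exists_schwartzMap
  exact isSchwartz_schwartzMap (F + G)

/-- Directional derivatives of a smooth function on an open set are smooth. -/
lemma ContDiffOn.fderiv_apply_const {E : Type*} [NormedAddCommGroup E] [NormedSpace ℝ E]
    {U : Set E} (hU : IsOpen U) {F : E → ℝ} (hF : ContDiffOn ℝ (⊤ : ℕ∞) F U) (u : E) :
    ContDiffOn ℝ (⊤ : ℕ∞) (fun q => fderiv ℝ F q u) U :=
  (hF.fderiv_of_isOpen hU (by simp)).clm_apply contDiffOn_const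

/-- Directional derivatives of a smooth function commute. -/
lemma fderiv_fderiv_apply_comm {E : Type*} [NormedAddCommGroup E] [NormedSpace ℝ E]
    {U : Set E} (hU : IsOpen U) {F : E → ℝ} (hF : ContDiffOn ℝ (⊤ : ℕ∞) F U) (u w : E)
    {q : E} (hq : q ∈ U) :
    fderiv ℝ (fun p => fderiv ℝ F p u) q w = fderiv ℝ (fun p => fderiv ℝ F p w) q u := by
  have hF' : ContDiffAt ℝ (⊤ : ℕ∞) F q := hF.contDiffAt (hU.mem_nhds hq)
  have hs : IsSymmSndFDerivAt ℝ F q := hF'.isSymmSndFDerivAt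
    (by rw [minSmoothness_of_isRCLikeNormedField]; exact WithTop.coe_le_coe.2 (le_top (a := (2 : ℕ∞))))
  have hd : DifferentiableAt ℝ (fderiv ℝ F) q :=
    ((hF.fderiv_of_isOpen (m := (⊤ : ℕ∞)) hU (by simp)).contDiffAt (hU.mem_nhds hq)).differentiableAt
      (by simp)
  rw [fderiv_clm_apply hd (differentiableAt_const _), fderiv_clm_apply hd (differentiableAt_const _)]
  simpa using hs w u

lemma pd_comm {f : Pt → ℝ} (hf : ContDiff ℝ (⊤ : ℕ∞) f) (i j : Fin 3) :
    pd i (pd j f) = pd j (pd i f) := by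
  funext x
  exact fderiv_fderiv_apply_comm isOpen_univ hf.contDiffOn _ _ (mem_univ x)

lemma pd_mul {f g : Pt → ℝ} (hf : Differentiable ℝ f) (hg : Differentiable ℝ g) (i : Fin 3) :
    pd i (fun x => f x * g x) = fun x => pd i f x * g x + f x * pd i g x := by
  funext x
  simp [pd, fderiv_fun_mul (hf x) (hg x)]
  ring

lemma pd_add {f g : Pt → ℝ} (hf : Differentiable ℝ f) (hg : Differentiable ℝ g) (i : Fin 3) :
    pd i (fun x => f x + g x) = fun x => pd i f x + pd i g x := by
  funext x
  simp [pd, fderiv_fun_add (hf x) (hg x)]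

lemma pd_neg (f : Pt → ℝ) (i : Fin 3) :
    pd i (fun x => -f x) = fun x => -pd i f x := by
  funext x
  simp [pd]

lemma integral_mul_pd {f g : Pt → ℝ} (i : Fin 3) (hf : Differentiable ℝ f)
    (hg : Differentiable ℝ g) (h1 : Integrable fun x => pd i f x * g x)
    (h2 : Integrable fun x => f x * pd i g x) (h3 : Integrable fun x => f x * g x) :
    ∫ x, f x * pd i g x = -∫ x, pd i f x * g x :=
  integral_mul_fderiv_eq_neg_fderiv_mul_of_integrable h1 h2 h3 (fun x _ => hf x) (fun x _ => hg x)

/-- The `L²` norm. -/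
def n2 (f : Pt → ℝ) : ℝ := √(l2Sq f)

lemma n2_nonneg (f : Pt → ℝ) : 0 ≤ n2 f := sqrt_nonneg _

lemma integrable_mul_of_memLp_two {f g : Pt → ℝ} (hf : MemLp f 2) (hg : MemLp g 2) :
    Integrable fun x => f x * g x := by
  simpa [Pi.mul_def] using hf.integrable_mul hg

/-- Cauchy–Schwarz. -/
lemma integral_abs_mul_le {f g : Pt → ℝ} (hf : MemLp f 2) (hg : MemLp g 2) :
    ∫ x, |f x * g x| ≤ n2 f * n2 g := by
  have h := integral_mul_norm_le_Lp_mul_Lq (μ := (volume : Measure Pt)) (f := f) (g := g)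
    (p := 2) (q := 2) Real.HolderConjugate.two_two (by simpa using hf) (by simpa using hg)
  simp only [norm_eq_abs, ← abs_mul] at h
  refine h.trans (le_of_eq ?_)
  simp [n2, l2Sq, sqrt_eq_rpow]

/-- Cauchy–Schwarz with a bounded weight. -/
lemma integral_abs_weight_mul_le {m f g : Pt → ℝ} {M : ℝ} (hm : ∀ x, |m x| ≤ M)
    (hf : MemLp f 2) (hg : MemLp g 2) :
    ∫ x, |m x * f x * g x| ≤ M * (n2 f * n2 g) := by
  have hM : 0 ≤ M := (abs_nonneg _).trans (hm 0)
  calc ∫ x, |m x * f x * g x| ≤ ∫ x, M * |f x * g x| := by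
        refine integral_mono_of_nonneg (ae_of_all _ fun _ => abs_nonneg _)
          ((integrable_mul_of_memLp_two hf hg).abs.const_mul M) (ae_of_all _ fun x => ?_)
        simp only [mul_assoc, abs_mul (m x)]
        gcongr
        exact hm x
    _ ≤ M * (n2 f * n2 g) := by
        rw [integral_const_mul]
        gcongr
        exact integral_abs_mul_le hf hg

lemma integrable_weight_mul {m f g : Pt → ℝ} {M : ℝ} (hm : ∀ x, |m x| ≤ M) (hmc : Continuous m)
    (hf : MemLp f 2) (hg : MemLp g 2) : Integrable fun x => m x * f x * g x := by
  simp only [mul_assoc]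
  exact (integrable_mul_of_memLp_two hf hg).bdd_mul hmc.aestronglyMeasurable
    (ae_of_all _ fun x => hm x)

lemma pdM_sq_le_hSq {k : ℕ} {α : Fin 3 → ℕ} (hα : ∑ i, α i ≤ k) (f : Pt → ℝ) :
    l2Sq (pdM α f) ≤ hSq k f := by
  have hmem : α ∈ midx k := by
    simp only [midx, Finset.mem_filter, Fintype.mem_piFinset, Finset.mem_range]
    exact ⟨fun i => Nat.lt_succ_of_le
      ((Finset.single_le_sum (fun j _ => Nat.zero_le (α j)) (Finset.mem_univ i)).trans hα), hα⟩
  have := Finset.single_le_sum (f := fun α => ∫ x, pdM α f x * pdM α f x)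
    (fun β _ => integral_nonneg fun x => mul_self_nonneg (pdM β f x)) hmem
  simpa [hSq, hInner, l2Sq, sq] using this

lemma hSq_nonneg (k : ℕ) (f : Pt → ℝ) : 0 ≤ hSq k f :=
  Finset.sum_nonneg fun _ _ => integral_nonneg fun _ => mul_self_nonneg _

lemma l2Sq_le_hSq (k : ℕ) (f : Pt → ℝ) : l2Sq f ≤ hSq k f := by
  simpa [pdM] using pdM_sq_le_hSq (k := k) (α := 0) (by simp) f

lemma l2Sq_pd_le_hSq {k : ℕ} (hk : 1 ≤ k) (f : Pt → ℝ) (i : Fin 3) :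
    l2Sq (pd i f) ≤ hSq k f := by
  have h := pdM_sq_le_hSq (k := k) (α := Pi.single i 1) (by simpa using hk) f
  fin_cases i <;> simpa [pdM] using h

lemma l2Sq_pd_pd_le_hSq {f : Pt → ℝ} (hf : ContDiff ℝ (⊤ : ℕ∞) f) (i j : Fin 3) :
    l2Sq (pd i (pd j f)) ≤ hSq 2 f := by
  have h := pdM_sq_le_hSq (k := 2) (α := Pi.single i 1 + Pi.single j 1)
    (by simp [Finset.sum_add_distrib]) f
  fin_cases i <;> fin_cases j <;> simp [pdM] at h ⊢ <;> first | exact h | (rw [pd_comm hf]; exact h)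

lemma hSq_one_le (f : Pt → ℝ) : hSq 1 f ≤ l2Sq f + ∑ i, l2Sq (pd i f) := by
  have : midx 1 = {0, Pi.single 0 1, Pi.single 1 1, Pi.single 2 1} := by decide
  have h0 : pdM 0 f = f := rfl
  have h1 : pdM (Pi.single 0 1) f = pd 0 f := rfl
  have h2 : pdM (Pi.single 1 1) f = pd 1 f := rfl
  have h3 : pdM (Pi.single 2 1) f = pd 2 f := rfl
  rw [hSq, hInner, this, Finset.sum_insert (by decide), Finset.sum_insert (by decide),
    Finset.sum_insert (by decide), Finset.sum_singleton, h0, h1, h2, h3]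
  simp [l2Sq, Fin.sum_univ_three, sq, add_assoc]

lemma hSq_one_pd_le {f : Pt → ℝ} (hf : ContDiff ℝ (⊤ : ℕ∞) f) (i : Fin 3) :
    hSq 1 (pd i f) ≤ 4 * hSq 2 f := by
  have h := hSq_one_le (pd i f)
  have h0 := l2Sq_pd_le_hSq (k := 2) (by norm_num) f i
  have h1 := fun j => l2Sq_pd_pd_le_hSq hf j i
  rw [Fin.sum_univ_three] at h
  linarith [h1 0, h1 1, h1 2]

open Topology in
/-- Smooth cutoffs at scale `n + 1`. -/
lemma exists_cutoff : ∃ (χ : ℕ → Pt → ℝ) (L : ℝ), 0 ≤ L ∧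
    (∀ n, ContDiff ℝ (⊤ : ℕ∞) (χ n)) ∧ (∀ n, HasCompactSupport (χ n)) ∧
    (∀ n x, 0 ≤ χ n x) ∧ (∀ n x, χ n x ≤ 1) ∧
    (∀ n x, ‖fderiv ℝ (χ n) x‖ ≤ L / (n + 1)) ∧
    ∀ x, Tendsto (fun n => χ n x) atTop (𝓝 1) := by
  let b : ContDiffBump (0 : Pt) := ⟨1, 2, by norm_num, by norm_num⟩
  have hb : ContDiff ℝ (⊤ : ℕ∞) b := b.contDiff
  obtain ⟨L, hL⟩ : ∃ L, ∀ x, ‖fderiv ℝ b x‖ ≤ L :=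
    (hb.continuous_fderiv (by simp)).bounded_above_of_compact_support
      (b.hasCompactSupport.fderiv (𝕜 := ℝ))
  have hpos : ∀ n : ℕ, (0 : ℝ) < (n + 1 : ℝ)⁻¹ := fun n => by positivity
  refine ⟨fun n x => b ((n + 1 : ℝ)⁻¹ • x), L, (norm_nonneg _).trans (hL 0), fun n => ?_, fun n => ?_,
    fun n x => b.nonneg, fun n x => b.le_one, fun n x => ?_, fun x => ?_⟩
  · exact hb.comp (contDiff_const_smul _)
  · exact b.hasCompactSupport.comp_smul (hpos n).ne'
  · rw [fderiv_comp_smul, norm_smul, norm_of_nonneg (hpos n).le, div_eq_inv_mul]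
    gcongr
    exact hL _
  · have h0 : Tendsto (fun n : ℕ => ((n : ℝ) + 1)⁻¹ • x) atTop (𝓝 ((0 : ℝ) • x)) :=
      (tendsto_inv_atTop_zero.comp
        (tendsto_atTop_add_const_right _ 1 tendsto_natCast_atTop_atTop)).smul_const x
    rw [zero_smul] at h0
    have h1 := (hb.continuous.tendsto 0).comp h0
    rwa [b.one_of_mem_closedBall (by simp [b])] at h1

lemma IsSchwartz.memLp_fderiv {f : Pt → ℝ} (hf : IsSchwartz f) (p : ℝ≥0∞) :
    MemLp (fderiv ℝ f) p := by
  obtain ⟨F, rfl⟩ := hf.exists_schwartzMap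
  exact (SchwartzMap.fderivCLM ℝ Pt ℝ F).memLp p

lemma fderiv_apply_eq_sum (f : Pt → ℝ) (x y : Pt) :
    fderiv ℝ f x y = ∑ i, y i * pd i f x := by
  conv_lhs => rw [pi_eq_sum_univ' y]
  simp [pd, Pi.single]

lemma norm_fderiv_sq_le (f : Pt → ℝ) (x : Pt) :
    ‖fderiv ℝ f x‖ ^ 2 ≤ 3 * ∑ i, (pd i f x) ^ 2 := by
  have h : ‖fderiv ℝ f x‖ ≤ ∑ i, |pd i f x| := by
    refine ContinuousLinearMap.opNorm_le_bound _ (Finset.sum_nonneg fun _ _ => abs_nonneg _)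
      fun y => ?_
    rw [fderiv_apply_eq_sum, Finset.sum_mul]
    refine (Finset.abs_sum_le_sum_abs _ _).trans (Finset.sum_le_sum fun i _ => ?_)
    rw [abs_mul, mul_comm]
    gcongr
    exact norm_le_pi_norm y i
  calc ‖fderiv ℝ f x‖ ^ 2 ≤ (∑ i, |pd i f x|) ^ 2 := by gcongr
    _ ≤ 3 * ∑ i, |pd i f x| ^ 2 := by
        simpa using sq_sum_le_card_mul_sum_sq (s := Finset.univ) (f := fun i => |pd i f x|)
    _ = _ := by simp

open Topology in
/-- The Sobolev inequality `‖f‖_{L⁶} ≤ C ‖∇f‖_{L²}`. -/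
lemma exists_sobolev_six : ∃ C : ℝ, 0 < C ∧ ∀ f : Pt → ℝ, IsSchwartz f →
    ∫ x, f x ^ 6 ≤ (C * √(∑ i, l2Sq (pd i f))) ^ 6 := by
  obtain ⟨χ, L, hL, hsm, hcs, h0, h1, hd, hlim⟩ := exists_cutoff
  set K : ℝ≥0 := SNormLESNormFDerivOfEqConst ℝ (volume : Measure Pt) (2 : ℝ≥0) with hK
  refine ⟨(K + 1) * √3, by positivity, fun f hf => ?_⟩
  have hn : ∀ n, eLpNorm (fun x => χ n x * f x) 6 volume ≤
      K * (eLpNorm (fderiv ℝ f) 2 volume +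
        ENNReal.ofReal (L / (n + 1)) * eLpNorm f 2 volume) := by
    intro n
    have hc1 : ContDiff ℝ 1 (fun x => χ n x * f x) :=
      ((hsm n).mul hf.1).of_le (by exact_mod_cast le_top)
    have := eLpNorm_le_eLpNorm_fderiv_of_eq (volume : Measure Pt) hc1 (hcs n).mul_right
      (p := 2) (p' := 6) (by norm_num) (by simp) (by simp; norm_num)
    refine this.trans ?_
    rw [← hK]
    gcongr
    have hfd : fderiv ℝ (fun x => χ n x * f x) =
        (fun x => χ n x • fderiv ℝ f x) + fun x => f x • fderiv ℝ (χ n) x := by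
      funext x
      rw [fderiv_fun_mul ((hsm n).differentiable (by simp) x) (hf.differentiable x)]
      rfl
    rw [hfd]
    have hm1 : AEStronglyMeasurable (fun x => χ n x • fderiv ℝ f x) (volume : Measure Pt) :=
      ((hsm n).continuous.smul (hf.1.continuous_fderiv (by simp))).aestronglyMeasurable
    have hm2 : AEStronglyMeasurable (fun x => f x • fderiv ℝ (χ n) x) (volume : Measure Pt) :=
      (hf.continuous.smul ((hsm n).continuous_fderiv (by simp))).aestronglyMeasurable
    refine (eLpNorm_add_le hm1 hm2 (by norm_num)).trans (add_le_add ?_ ?_)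
    · refine eLpNorm_mono fun x => ?_
      rw [norm_smul, norm_of_nonneg (h0 n x)]
      exact mul_le_of_le_one_left (norm_nonneg _) (h1 n x)
    · refine eLpNorm_le_mul_eLpNorm_of_ae_le_mul (ae_of_all _ fun x => ?_) 2
      rw [norm_smul, mul_comm]
      gcongr
      exact hd n x
  have hL0 : Tendsto (fun n : ℕ => L / ((n : ℝ) + 1)) atTop (𝓝 0) :=
    tendsto_const_nhds.div_atTop
      (tendsto_atTop_add_const_right _ 1 tendsto_natCast_atTop_atTop)
  have hlim2 : Tendsto (fun n : ℕ => (K : ℝ≥0∞) * (eLpNorm (fderiv ℝ f) 2 volume +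
        ENNReal.ofReal (L / (n + 1)) * eLpNorm f 2 volume)) atTop
        (𝓝 (K * (eLpNorm (fderiv ℝ f) 2 volume + ENNReal.ofReal 0 * eLpNorm f 2 volume))) := by
    refine ENNReal.Tendsto.const_mul (tendsto_const_nhds.add ?_) (Or.inr (by simp))
    exact ENNReal.Tendsto.mul_const (ENNReal.tendsto_ofReal hL0) (Or.inr (hf.memLp 2).eLpNorm_ne_top)
  have hfin : eLpNorm f 6 volume ≤ K * eLpNorm (fderiv ℝ f) 2 volume := by
    have hfatou := Lp.eLpNorm_lim_le_liminf_eLpNorm (p := 6) (μ := (volume : Measure Pt))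
      (f := fun n x => χ n x * f x)
      (fun n => ((hsm n).continuous.mul hf.continuous).aestronglyMeasurable) f
      (ae_of_all _ fun x => by simpa using (hlim x).mul_const (f x))
    refine hfatou.trans ((liminf_le_liminf (Eventually.of_forall hn)).trans ?_)
    rw [hlim2.liminf_eq]
    simp
  have e6 := (hf.memLp 6).eLpNorm_eq_integral_rpow_norm (by norm_num) (by norm_num)
  have e2 := (hf.memLp_fderiv 2).eLpNorm_eq_integral_rpow_norm (by norm_num) (by norm_num)
  rw [e6, e2, ← ENNReal.ofReal_coe_nnreal, ← ENNReal.ofReal_mul (by positivity),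
    ENNReal.ofReal_le_ofReal_iff (by positivity)] at hfin
  have t6 : (6 : ℝ≥0∞).toReal = 6 := by norm_num
  have t2 : (2 : ℝ≥0∞).toReal = 2 := by norm_num
  simp only [t6, t2, norm_eq_abs] at hfin
  have i6 : ∫ x, f x ^ 6 = ∫ x, |f x| ^ (6 : ℝ) := by
    congr 1; funext x
    rw [show (6 : ℝ) = ((6 : ℕ) : ℝ) by norm_num, rpow_natCast, Even.pow_abs (by decide)]
  have i2 : ∫ x, ‖fderiv ℝ f x‖ ^ (2 : ℝ) ≤ 3 * ∑ i, l2Sq (pd i f) := by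
    have : ∀ i, Integrable fun x => pd i f x ^ 2 := fun i => ((hf.pd i).memLp 2).integrable_sq
    simp only [l2Sq]
    rw [← integral_finsetSum _ fun i _ => this i, ← integral_const_mul]
    refine integral_mono_of_nonneg (ae_of_all _ fun x => by positivity)
      ((integrable_finsetSum _ fun i _ => this i).const_mul 3) (ae_of_all _ fun x => ?_)
    simpa using norm_fderiv_sq_le f x
  have hI : 0 ≤ ∫ x, |f x| ^ (6 : ℝ) := by positivity
  rw [i6]
  calc ∫ x, |f x| ^ (6 : ℝ) = ((∫ x, |f x| ^ (6 : ℝ)) ^ (6 : ℝ)⁻¹) ^ 6 := by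
        rw [← rpow_natCast, ← rpow_mul hI]; norm_num
    _ ≤ _ := by
        gcongr
        refine hfin.trans ?_
        rw [show (2 : ℝ)⁻¹ = 1 / 2 by norm_num, ← sqrt_eq_rpow, mul_assoc, ← sqrt_mul (by norm_num)]
        gcongr
        linarith

/-- The `H¹` norm. -/
def h1 (f : Pt → ℝ) : ℝ := √(hSq 1 f)

lemma h1_nonneg (f : Pt → ℝ) : 0 ≤ h1 f := sqrt_nonneg _

lemma n2_le_h1 (f : Pt → ℝ) : n2 f ≤ h1 f := sqrt_le_sqrt (l2Sq_le_hSq 1 f)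

lemma sum_l2Sq_pd_le (f : Pt → ℝ) : ∑ i, l2Sq (pd i f) ≤ 3 * hSq 1 f := by
  rw [Fin.sum_univ_three]
  linarith [l2Sq_pd_le_hSq le_rfl f 0, l2Sq_pd_le_hSq le_rfl f 1, l2Sq_pd_le_hSq le_rfl f 2]

/-- `‖fg‖_{L²} ≤ C ‖f‖_{H¹} ‖g‖_{H¹}`. -/
lemma exists_n2_mul_le : ∃ C : ℝ, 0 < C ∧ ∀ f g : Pt → ℝ, IsSchwartz f → IsSchwartz g →
    n2 (fun x => f x * g x) ≤ C * h1 f * h1 g := by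
  obtain ⟨C, hC, h⟩ := exists_sobolev_six
  set D := √((C * √3) ^ 3) with hD
  have key : ∀ f : Pt → ℝ, IsSchwartz f → n2 (fun x => f x * f x) ≤ D * h1 f ^ 2 := by
    intro f hf
    have c := integral_abs_mul_le (hf.memLp 2) ((hf.mul (hf.mul hf)).memLp 2)
    have e : l2Sq (fun x => f x * f x) = ∫ x, |f x * (f x * (f x * f x))| := by
      simp only [l2Sq]
      congr 1; funext x
      rw [abs_of_nonneg (by nlinarith [mul_self_nonneg (f x * f x)])]
      ring
    have s : n2 (fun x => f x * (f x * f x)) ≤ (C * √3 * h1 f) ^ 3 := by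
      rw [n2, sqrt_le_left (by have := h1_nonneg f; positivity)]
      calc l2Sq (fun x => f x * (f x * f x)) = ∫ x, f x ^ 6 := by
            simp only [l2Sq]; congr 1; funext x; ring
        _ ≤ _ := h f hf
        _ ≤ (C * (√3 * h1 f)) ^ 6 := by
            rw [h1, ← sqrt_mul (by norm_num)]
            gcongr
            exact sum_l2Sq_pd_le f
        _ = _ := by ring
    have := h1_nonneg f
    rw [n2, sqrt_le_left (by positivity), e]
    calc _ ≤ _ := c
      _ ≤ h1 f * (C * √3 * h1 f) ^ 3 := by
          exact mul_le_mul (n2_le_h1 f) s (n2_nonneg _) this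
      _ = (C * √3) ^ 3 * h1 f ^ 4 := by ring
      _ = _ := by rw [mul_pow D, hD, sq_sqrt (by positivity)]; ring
  refine ⟨D, by positivity, fun f g hf hg => ?_⟩
  have c := integral_abs_mul_le ((hf.mul hf).memLp 2) ((hg.mul hg).memLp 2)
  have e : l2Sq (fun x => f x * g x) = ∫ x, |f x * f x * (g x * g x)| := by
    simp only [l2Sq]
    congr 1; funext x
    rw [abs_of_nonneg (by nlinarith [mul_self_nonneg (f x * g x)])]
    ring
  have hf1 := h1_nonneg f
  have hg1 := h1_nonneg g
  rw [n2, sqrt_le_left (by positivity), e]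
  calc _ ≤ _ := c
    _ ≤ (D * h1 f ^ 2) * (D * h1 g ^ 2) :=
        mul_le_mul (key f hf) (key g hg) (n2_nonneg _) (by positivity)
    _ = _ := by ring

/-- Averages over rescaled unit cubes are controlled by the `L⁶` norm. -/
lemma setIntegral_abs_comp_smul_le {g : Pt → ℝ} (hg : IsSchwartz g) {m : ℝ} (hm : 0 ≤ m)
    (h : ∫ x, g x ^ 6 ≤ m ^ 6) (x₀ : Pt) {t : ℝ} (ht : 0 < t) :
    ∫ y in Icc (0 : Pt) 1, |g (x₀ + t • y)| ≤ m * t ^ (-(1 / 2) : ℝ) := by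
  have hprob : IsProbabilityMeasure ((volume : Measure Pt).restrict (Icc 0 1)) :=
    ⟨by simp [Real.volume_Icc_pi]⟩
  have hc : Continuous fun y : Pt => |g (x₀ + t • y)| :=
    (hg.continuous.comp (by fun_prop)).abs
  have hi : ∀ F : Pt → ℝ, Continuous F → IntegrableOn F (Icc (0 : Pt) 1) := fun F hF =>
    hF.continuousOn.integrableOn_compact isCompact_Icc
  have hJ := (convexOn_pow 6).map_integral_le (μ := (volume : Measure Pt).restrict (Icc 0 1))
    (f := fun y => |g (x₀ + t • y)|) (by fun_prop) isClosed_Ici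
    (ae_of_all _ fun y => mem_Ici.2 (abs_nonneg _)) (hi _ hc) (hi _ (hc.pow 6))
  have hint6 : Integrable fun x => g x ^ 6 := by
    have := (hg.mul (hg.mul (hg.mul (hg.mul (hg.mul hg))))).integrable
    refine this.congr (ae_of_all _ fun x => ?_)
    simp only
    ring
  have hscale : ∫ y, g (x₀ + t • y) ^ 6 = t⁻¹ ^ 3 * ∫ x, g x ^ 6 := by
    rw [Measure.integral_comp_smul (volume : Measure Pt) (fun z => g (x₀ + z) ^ 6) t,
      integral_add_left_eq_self (fun z => g z ^ 6) x₀]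
    simp [abs_of_pos ht]
  have hint6' : Integrable fun y : Pt => g (x₀ + t • y) ^ 6 :=
    (integrable_comp_smul_iff (volume : Measure Pt) (fun z => g (x₀ + z) ^ 6) ht.ne').2
      (hint6.comp_add_left x₀)
  have hle : (∫ y in Icc (0 : Pt) 1, |g (x₀ + t • y)|) ^ 6 ≤ (m * t ^ (-(1 / 2) : ℝ)) ^ 6 :=
    calc _ ≤ _ := hJ
      _ = ∫ y in Icc (0 : Pt) 1, g (x₀ + t • y) ^ 6 := by
          simp only [Even.pow_abs (show Even 6 by decide)]
      _ ≤ ∫ y, g (x₀ + t • y) ^ 6 :=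
          setIntegral_le_integral hint6' (ae_of_all _ fun y => Even.pow_nonneg (by decide) _)
      _ ≤ t⁻¹ ^ 3 * m ^ 6 := by rw [hscale]; gcongr
      _ = _ := by
          rw [mul_pow, ← rpow_natCast (t ^ _), ← rpow_mul ht.le, inv_pow, ← rpow_natCast t 3,
            ← rpow_neg ht.le, mul_comm]
          norm_num
  exact le_of_pow_le_pow_left₀ (by norm_num) (by positivity) hle

lemma abs_le_abs_add_integral {f : Pt → ℝ} (hf : IsSchwartz f) (x₀ : Pt) {y : Pt}
    (hy : y ∈ Icc (0 : Pt) 1) :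
    |f x₀| ≤ |f (x₀ + y)| + ∫ t in (0 : ℝ)..1, ∑ i, |pd i f (x₀ + t • y)| := by
  have hderiv : ∀ t : ℝ, HasDerivAt (fun s : ℝ => f (x₀ + s • y)) (fderiv ℝ f (x₀ + t • y) y) t := by
    intro t
    have h1 : HasDerivAt (fun s : ℝ => x₀ + s • y) y t := by
      simpa using ((hasDerivAt_id t).smul_const y).const_add x₀
    exact (hf.differentiable (x₀ + t • y)).hasFDerivAt.comp_hasDerivAt t h1
  have hcont : Continuous fun t : ℝ => fderiv ℝ f (x₀ + t • y) y :=
    ((hf.1.continuous_fderiv (by simp)).comp (by fun_prop)).clm_apply continuous_const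
  have hftc := intervalIntegral.integral_eq_sub_of_hasDerivAt (a := 0) (b := 1)
    (fun t _ => hderiv t) (hcont.intervalIntegrable _ _)
  have hb : ∀ t : ℝ, |fderiv ℝ f (x₀ + t • y) y| ≤ ∑ i, |pd i f (x₀ + t • y)| := by
    intro t
    rw [fderiv_apply_eq_sum]
    refine (Finset.abs_sum_le_sum_abs _ _).trans (Finset.sum_le_sum fun i _ => ?_)
    rw [abs_mul, abs_of_nonneg (hy.1 i)]
    exact mul_le_of_le_one_left (abs_nonneg _) (hy.2 i)
  have hcs : Continuous fun t : ℝ => ∑ i, |pd i f (x₀ + t • y)| :=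
    continuous_finsetSum _ fun i _ => ((hf.pd i).continuous.comp (by fun_prop)).abs
  have hle : |∫ t in (0 : ℝ)..1, fderiv ℝ f (x₀ + t • y) y| ≤
      ∫ t in (0 : ℝ)..1, ∑ i, |pd i f (x₀ + t • y)| :=
    (intervalIntegral.abs_integral_le_integral_abs zero_le_one).trans
      (intervalIntegral.integral_mono_on zero_le_one (hcont.abs.intervalIntegrable _ _)
        (hcs.intervalIntegrable _ _) fun t _ => hb t)
  rw [hftc] at hle
  simp only [one_smul, zero_smul, add_zero] at hle
  have := abs_sub_abs_le_abs_sub (f x₀) (f (x₀ + y))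
  rw [abs_sub_comm] at this
  linarith

/-- The Sobolev embedding `‖f‖_{L^∞} ≤ C ‖∇f‖_{H¹}`. -/
lemma exists_abs_le_gradient : ∃ C : ℝ, 0 < C ∧ ∀ f : Pt → ℝ, IsSchwartz f →
    ∀ x, |f x| ≤ C * √(gradHSq 1 f) := by
  obtain ⟨C, hC, h⟩ := exists_sobolev_six
  refine ⟨7 * (C * √3), by positivity, fun f hf x₀ => ?_⟩
  set S := gradHSq 1 f with hS
  set m := C * √3 * √S with hm
  have hm0 : 0 ≤ m := by positivity
  have hle : ∀ i, hSq 1 (pd i f) ≤ S := fun i =>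
    Finset.single_le_sum (f := fun i => hSq 1 (pd i f)) (fun j _ => hSq_nonneg _ _)
      (Finset.mem_univ i)
  have hS0 : 0 ≤ S := (hSq_nonneg _ _).trans (hle 0)
  have hgen : ∀ g : Pt → ℝ, IsSchwartz g → ∑ i, l2Sq (pd i g) ≤ 3 * S →
      ∫ x, g x ^ 6 ≤ m ^ 6 := by
    intro g hg hgS
    refine (h g hg).trans ?_
    rw [hm, mul_assoc, ← sqrt_mul (by norm_num)]
    gcongr
  have h6 : ∫ x, f x ^ 6 ≤ m ^ 6 := by
    refine hgen f hf ?_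
    have := Finset.sum_le_sum fun i (_ : i ∈ Finset.univ) => l2Sq_le_hSq 1 (pd i f)
    have h' : ∑ i, hSq 1 (pd i f) = S := rfl
    linarith
  have h6' : ∀ i, ∫ x, pd i f x ^ 6 ≤ m ^ 6 := fun i => by
    refine hgen _ (hf.pd i) ((sum_l2Sq_pd_le _).trans ?_)
    linarith [hle i]
  set Q : Set Pt := Icc 0 1 with hQ
  have hprob : IsProbabilityMeasure ((volume : Measure Pt).restrict Q) :=
    ⟨by simp [hQ, Real.volume_Icc_pi]⟩
  have hcj : Continuous (Function.uncurry fun (t : ℝ) (y : Pt) => ∑ i, |pd i f (x₀ + t • y)|) :=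
    continuous_finsetSum _ fun i _ => ((hf.pd i).continuous.comp (by fun_prop)).abs
  have hintj : Integrable (Function.uncurry fun (t : ℝ) (y : Pt) => ∑ i, |pd i f (x₀ + t • y)|)
      ((volume.restrict (uIoc (0 : ℝ) 1)).prod (volume.restrict Q)) := by
    have hfin : IsFiniteMeasure ((volume : Measure ℝ).restrict (uIoc 0 1)) :=
      ⟨by simp⟩
    choose c hc using fun i => (hf.pd i).bounded
    refine Integrable.of_bound hcj.aestronglyMeasurable (∑ i, c i) (ae_of_all _ fun q => ?_)
    simp only [Function.uncurry, norm_eq_abs]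
    rw [abs_of_nonneg (Finset.sum_nonneg fun _ _ => abs_nonneg _)]
    exact Finset.sum_le_sum fun i _ => hc i _
  have hswap := intervalIntegral_integral_swap hintj
  have hi : ∀ F : Pt → ℝ, Continuous F → IntegrableOn F Q := fun F hF =>
    hF.continuousOn.integrableOn_compact isCompact_Icc
  have hi1 : IntegrableOn (fun y : Pt => |f (x₀ + y)|) Q :=
    hi _ (hf.continuous.comp (by fun_prop)).abs
  have hi2 : IntegrableOn (fun y : Pt => ∫ t in (0 : ℝ)..1, ∑ i, |pd i f (x₀ + t • y)|) Q := by
    refine hi _ ?_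
    exact intervalIntegral.continuous_parametric_intervalIntegral_of_continuous'
      (f := fun (y : Pt) (t : ℝ) => ∑ i, |pd i f (x₀ + t • y)|) (hcj.comp continuous_swap) 0 1
  have hmain : |f x₀| ≤ (∫ y in Q, |f (x₀ + y)|) +
      ∫ t in (0 : ℝ)..1, ∫ y in Q, ∑ i, |pd i f (x₀ + t • y)| := by
    rw [hswap, ← integral_add hi1 hi2]
    calc |f x₀| = ∫ y in Q, |f x₀| := by simp
      _ ≤ _ := setIntegral_mono_on (integrable_const _) (hi1.add hi2) measurableSet_Icc
          fun y hy => abs_le_abs_add_integral hf x₀ hy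
  have hb1 : ∫ y in Q, |f (x₀ + y)| ≤ m := by
    simpa using setIntegral_abs_comp_smul_le hf hm0 h6 x₀ one_pos
  have hrp : IntervalIntegrable (fun t : ℝ => 3 * (m * t ^ (-(1 / 2) : ℝ))) volume 0 1 :=
    ((intervalIntegral.intervalIntegrable_rpow' (by norm_num)).const_mul m).const_mul 3
  have hb2 : ∫ t in (0 : ℝ)..1, ∫ y in Q, ∑ i, |pd i f (x₀ + t • y)| ≤ 6 * m := by
    calc _ ≤ ∫ t in (0 : ℝ)..1, 3 * (m * t ^ (-(1 / 2) : ℝ)) := by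
          rw [intervalIntegral.integral_of_le zero_le_one, intervalIntegral.integral_of_le zero_le_one]
          refine integral_mono_of_nonneg (ae_of_all _ fun t => integral_nonneg fun y =>
            Finset.sum_nonneg fun _ _ => abs_nonneg _) hrp.1 ?_
          refine (ae_restrict_iff' measurableSet_Ioc).2 (ae_of_all _ fun t ht => ?_)
          simp only
          rw [integral_finsetSum _ fun i _ => hi (fun y => |pd i f (x₀ + t • y)|)
            ((hf.pd i).continuous.comp (by fun_prop)).abs]
          calc _ ≤ ∑ i : Fin 3, m * t ^ (-(1 / 2) : ℝ) := Finset.sum_le_sum fun i _ =>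
                setIntegral_abs_comp_smul_le (hf.pd i) hm0 (h6' i) x₀ ht.1
            _ = _ := by simp
      _ = 6 * m := by
          rw [intervalIntegral.integral_const_mul, intervalIntegral.integral_const_mul,
            integral_rpow (Or.inl (by norm_num))]
          norm_num
          ring
  calc |f x₀| ≤ 7 * m := by linarith
    _ = _ := by rw [hm]; ring

/-- Bounded continuous functions. -/
def Tame (f : Pt → ℝ) : Prop := Continuous f ∧ ∃ M, ∀ x, |f x| ≤ M

lemma IsSchwartz.tame {f : Pt → ℝ} (hf : IsSchwartz f) : Tame f := ⟨hf.continuous, hf.bounded⟩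

lemma Tame.mul {f g : Pt → ℝ} (hf : Tame f) (hg : Tame g) : Tame fun x => f x * g x := by
  obtain ⟨hf, M, hM⟩ := hf
  obtain ⟨hg, N, hN⟩ := hg
  refine ⟨hf.mul hg, M * N, fun x => ?_⟩
  rw [abs_mul]
  exact mul_le_mul (hM x) (hN x) (abs_nonneg _) ((abs_nonneg _).trans (hM x))

lemma Tame.add {f g : Pt → ℝ} (hf : Tame f) (hg : Tame g) : Tame fun x => f x + g x := by
  obtain ⟨hf, M, hM⟩ := hf
  obtain ⟨hg, N, hN⟩ := hg
  exact ⟨hf.add hg, M + N, fun x => (abs_add_le _ _).trans (add_le_add (hM x) (hN x))⟩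

lemma tame_const (c : ℝ) : Tame fun _ => c := ⟨continuous_const, |c|, fun _ => le_rfl⟩

lemma Tame.mul_integrable {f g : Pt → ℝ} (hf : Tame f) (hg : Integrable g) :
    Integrable fun x => f x * g x := by
  obtain ⟨hf, M, hM⟩ := hf
  exact hg.bdd_mul hf.aestronglyMeasurable (ae_of_all _ hM)

lemma integrable_and_abs_integral_le {m f g : Pt → ℝ} {M α β : ℝ} (hmc : Continuous m)
    (hm : ∀ x, |m x| ≤ M) (hf : MemLp f 2) (hg : MemLp g 2) (hα : n2 f ≤ α) (hβ : n2 g ≤ β) :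
    Integrable (fun x => m x * f x * g x) ∧ ∫ x, |m x * f x * g x| ≤ M * (α * β) := by
  refine ⟨integrable_weight_mul hm hmc hf hg, (integral_abs_weight_mul_le hm hf hg).trans ?_⟩
  have : 0 ≤ M := (abs_nonneg _).trans (hm 0)
  have := (n2_nonneg f).trans hα
  have := n2_nonneg g
  gcongr

/-- Two integrations by parts moving a horizontal derivative from `F` to `s`. -/
lemma integral_mul_pd_two_mul_pd {p s F : Pt → ℝ} (hp : Differentiable ℝ p) (hpt : Tame p)
    (hpd : ∀ i, Tame (pd i p)) (hs : IsSchwartz s) (hF : IsSchwartz F) (h : Fin 3) :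
    ∫ x, p x * pd 2 s x * pd h F x =
      ∫ x, (-(pd h p x * pd 2 s x * F x) + pd 2 p x * F x * pd h s x
        + p x * pd 2 F x * pd h s x) := by
  have hw := hs.pd 2
  have hsh := hs.pd h
  have e1 := pd_mul hp hw.differentiable h
  have e2 := pd_mul hp hF.differentiable 2
  have i1 := hpt.mul_integrable ((hw.mul (hF.pd h)).integrable)
  have i2 := (hpd h).mul_integrable ((hw.mul hF).integrable)
  have i3 := hpt.mul_integrable (((hw.pd h).mul hF).integrable)
  have i4 := hpt.mul_integrable ((hw.mul hF).integrable)
  have i5 := (hpd 2).mul_integrable ((hF.mul hsh).integrable)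
  have i6 := hpt.mul_integrable (((hF.pd 2).mul hsh).integrable)
  have i7 := hpt.mul_integrable ((hF.mul hsh).integrable)
  have i8 := hpt.mul_integrable ((hF.mul (hsh.pd 2)).integrable)
  have b1 := integral_mul_pd (f := fun x => p x * pd 2 s x) (g := F) h
    (hp.mul hw.differentiable) hF.differentiable
    (by rw [e1]; exact (i2.add i3).congr (ae_of_all _ fun x => by simp only [Pi.add_apply]; ring))
    (by simpa only [mul_assoc] using i1) (by simpa only [mul_assoc] using i4)
  have b2 := integral_mul_pd (f := fun x => p x * F x) (g := pd h s) 2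
    (hp.mul hF.differentiable) hsh.differentiable
    (by rw [e2]; exact (i5.add i6).congr (ae_of_all _ fun x => by simp only [Pi.add_apply]; ring))
    (by simpa only [mul_assoc] using i8) (by simpa only [mul_assoc] using i7)
  rw [e1] at b1
  rw [e2] at b2
  rw [b1]
  have c1 : ∫ x, (pd h p x * pd 2 s x + p x * pd h (pd 2 s) x) * F x =
      (∫ x, pd h p x * (pd 2 s x * F x)) + ∫ x, p x * F x * pd 2 (pd h s) x := by
    rw [← integral_add i2 (by simpa only [mul_assoc] using i8)]
    congr 1; funext x
    rw [pd_comm hs.1 h 2]; ring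
  rw [c1, b2, ← sub_eq_add_neg, ← integral_sub i2, ← integral_neg]
  · congr 1; funext x; ring
  · exact (i5.add i6).congr (ae_of_all _ fun x => by simp only [Pi.add_apply]; ring)

/-- The contribution of the horizontal direction `h` to the remainder. -/
def hRem (φ κ ψ V : Pt → ℝ) (h : Fin 3) (x : Pt) : ℝ :=
  -(κ x * pd 2 (pd 2 (pd 2 ψ)) x ^ 2 * pd 2 V x * pd h ψ x)
  - 2 * (φ x * pd 2 (pd 2 (pd 2 ψ)) x * pd 2 (pd 2 (pd 2 V)) x * pd h ψ x)
  - 6 * (φ x * pd 2 (pd 2 (pd 2 ψ)) x * pd 2 (pd 2 V) x * pd h (pd 2 ψ) x)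
  - 6 * (φ x * pd 2 (pd 2 (pd 2 ψ)) x * pd 2 V x * pd h (pd 2 (pd 2 ψ)) x)
  + 2 * (φ x * (1 + pd 2 ψ x) * pd 2 (pd 2 (pd 2 ψ)) x * pd h (pd 2 (pd 2 V)) x)
  + 6 * (φ x * pd 2 (pd 2 ψ) x * pd 2 (pd 2 (pd 2 ψ)) x * pd h (pd 2 V) x)

lemma abs_integral_hRem_le {φ κ ψ V : Pt → ℝ} {h : Fin 3} (hψ : IsSchwartz ψ) (hV : IsSchwartz V)
    (hφ : Differentiable ℝ φ) (hκ : Continuous κ)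
    (hφd : ∀ i x, pd i φ x = κ x * pd i (pd 2 ψ) x)
    (hode : ∀ x, κ x * (1 + pd 2 ψ x) + 6 * φ x = 1)
    {Φ K Φ' K' U A P X₁ X₂ X₃ X₄ : ℝ}
    (bφ : ∀ x, |φ x| ≤ Φ) (bκ : ∀ x, |κ x| ≤ K)
    (bφ' : ∀ x, |φ x * (1 + pd 2 ψ x)| ≤ Φ') (bκ' : ∀ x, |1 - 5 * φ x| ≤ K')
    (bu : ∀ x, |pd 2 V x| ≤ U) (bψ : ∀ x, |pd h ψ x| ≤ U)
    (bw : n2 (pd 2 (pd 2 (pd 2 ψ))) ≤ A) (bs : n2 (pd h (pd 2 (pd 2 ψ))) ≤ P)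
    (bu3 : n2 (pd 2 (pd 2 (pd 2 V))) ≤ P)
    (b1 : n2 (fun x => pd 2 (pd 2 V) x * pd h (pd 2 ψ) x) ≤ X₁)
    (b2 : n2 (fun x => pd 2 (pd 2 V) x * pd 2 (pd 2 ψ) x) ≤ X₂)
    (b3 : n2 (fun x => pd h (pd 2 ψ) x * pd 2 (pd 2 ψ) x) ≤ X₃)
    (b4 : n2 (fun x => pd 2 (pd 2 ψ) x * pd 2 (pd 2 ψ) x) ≤ X₄) :
    Integrable (hRem φ κ ψ V h) ∧
    |∫ x, hRem φ κ ψ V h x| ≤ K * U * U * (A * A) + 2 * (Φ * U * (A * P)) + 6 * (Φ * (A * X₁))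
      + 6 * (Φ * U * (A * P)) + 2 * (K' * (A * X₁) + K' * (P * X₂) + Φ' * (P * P))
      + 6 * (K * U * (A * X₃) + K * U * (P * X₄) + Φ * (P * X₂)) := by
  set a := pd 2 ψ with ha
  set s := pd 2 a with hs
  set w := pd 2 s with hw
  set u := pd 2 V with hu
  set u2 := pd 2 u with hu2
  have Sa : IsSchwartz a := hψ.pd 2
  have Ss : IsSchwartz s := Sa.pd 2
  have Sw : IsSchwartz w := Ss.pd 2
  have Su : IsSchwartz u := hV.pd 2
  have Su2 : IsSchwartz u2 := Su.pd 2
  have Tφ : Tame φ := ⟨hφ.continuous, Φ, bφ⟩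
  have Tκ : Tame κ := ⟨hκ, K, bκ⟩
  have hφpd : ∀ i, pd i φ = fun x => κ x * pd i a x := fun i => funext fun x => hφd i x
  -- the two weights
  have d1 : ∀ i, pd i (fun x => φ x * (1 + a x)) = fun x => (1 - 5 * φ x) * pd i a x := by
    intro i
    have hone : Differentiable ℝ fun _ : Pt => (1 : ℝ) := differentiable_const 1
    have h1a : Differentiable ℝ fun x => 1 + a x := hone.add Sa.differentiable
    rw [pd_mul hφ h1a, pd_add hone Sa.differentiable, hφpd]
    funext x
    have : pd i (fun _ : Pt => (1 : ℝ)) x = 0 := by simp [pd]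
    beta_reduce
    rw [this]
    linear_combination (pd i a x) * hode x
  have d2 : ∀ i, pd i (fun x => φ x * s x) = fun x => κ x * pd i a x * s x + φ x * pd i s x := by
    intro i
    rw [pd_mul hφ Ss.differentiable, hφpd]
  have T1 : Tame fun x => 1 - 5 * φ x := by
    have := (tame_const 1).add ((tame_const (-5)).mul Tφ)
    convert this using 2
    ring
  have t1 := integral_mul_pd_two_mul_pd (p := fun x => φ x * (1 + a x)) (s := s) (F := u2)
    (hφ.mul ((differentiable_const 1).add Sa.differentiable))
    (Tφ.mul ((tame_const 1).add Sa.tame))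
    (fun i => by rw [d1]; exact T1.mul (Sa.pd i).tame) Ss Su2 h
  have t2 := integral_mul_pd_two_mul_pd (p := fun x => φ x * s x) (s := s) (F := u)
    (hφ.mul Ss.differentiable) (Tφ.mul Ss.tame)
    (fun i => by
      rw [d2]; exact ((Tκ.mul (Sa.pd i).tame).mul Ss.tame).add (Tφ.mul (Ss.pd i).tame)) Ss Su h
  rw [d1, d1] at t1
  rw [d2, d2] at t2
  have c1 : Continuous fun x => κ x * u x * pd h ψ x :=
    (hκ.mul Su.continuous).mul (hψ.pd h).continuous
  have c2 : Continuous fun x => φ x * pd h ψ x := hφ.continuous.mul (hψ.pd h).continuous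
  have c3 : Continuous fun x => φ x * u x := hφ.continuous.mul Su.continuous
  have c4 : Continuous fun x => κ x * u x := hκ.mul Su.continuous
  have m1 : ∀ x, |κ x * u x * pd h ψ x| ≤ K * U * U := fun x => by
    have := (abs_nonneg _).trans (bκ x)
    have := (abs_nonneg _).trans (bu x)
    rw [abs_mul, abs_mul]; gcongr <;> simp_all
  have m2 : ∀ x, |φ x * pd h ψ x| ≤ Φ * U := fun x => by
    have := (abs_nonneg _).trans (bφ x)
    rw [abs_mul]; gcongr <;> simp_all
  have m3 : ∀ x, |φ x * u x| ≤ Φ * U := fun x => by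
    have := (abs_nonneg _).trans (bφ x)
    rw [abs_mul]; gcongr <;> simp_all
  have m4 : ∀ x, |κ x * u x| ≤ K * U := fun x => by
    have := (abs_nonneg _).trans (bκ x)
    rw [abs_mul]; gcongr <;> simp_all
  have Lw := Sw.memLp 2
  have Lsh := (Ss.pd h).memLp 2
  obtain ⟨I1, E1⟩ := integrable_and_abs_integral_le c1 m1 Lw Lw bw bw
  obtain ⟨I2, E2⟩ := integrable_and_abs_integral_le c2 m2 Lw ((Su2.pd 2).memLp 2) bw bu3
  obtain ⟨I3, E3⟩ := integrable_and_abs_integral_le hφ.continuous bφ Lw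
    ((Su2.mul (Sa.pd h)).memLp 2) bw b1
  obtain ⟨I4, E4⟩ := integrable_and_abs_integral_le c3 m3 Lw Lsh bw bs
  obtain ⟨I5, E5⟩ := integrable_and_abs_integral_le T1.1 bκ' Lw ((Su2.mul (Sa.pd h)).memLp 2) bw b1
  obtain ⟨I6, E6⟩ := integrable_and_abs_integral_le T1.1 bκ' Lsh ((Su2.mul Ss).memLp 2) bs b2
  obtain ⟨I7, E7⟩ := integrable_and_abs_integral_le
    (m := fun x => φ x * (1 + a x)) (hφ.continuous.mul (continuous_const.add Sa.continuous)) bφ'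
    Lsh ((Su2.pd 2).memLp 2) bs bu3
  obtain ⟨I8, E8⟩ := integrable_and_abs_integral_le c4 m4 Lw (((Sa.pd h).mul Ss).memLp 2) bw b3
  obtain ⟨I9, E9⟩ := integrable_and_abs_integral_le c4 m4 Lsh ((Ss.mul Ss).memLp 2) bs b4
  obtain ⟨I10, E10⟩ := integrable_and_abs_integral_le hφ.continuous bφ Lsh
    ((Su2.mul Ss).memLp 2) bs b2
  have J1 : Integrable fun x => φ x * (1 + a x) * w x * pd h u2 x := by
    simpa only [mul_assoc] using
      (Tφ.mul ((tame_const 1).add Sa.tame)).mul_integrable (Sw.mul (Su2.pd h)).integrable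
  have J2 : Integrable fun x => φ x * s x * w x * pd h u x := by
    simpa only [mul_assoc] using (Tφ.mul Ss.tame).mul_integrable (Sw.mul (Su.pd h)).integrable
  have e1 : ∫ x, φ x * (1 + a x) * w x * pd h u2 x =
      -(∫ x, (1 - 5 * φ x) * w x * (u2 x * pd h a x))
      + (∫ x, (1 - 5 * φ x) * pd h s x * (u2 x * s x))
      + ∫ x, φ x * (1 + a x) * pd h s x * pd 2 u2 x := by
    have I65 : Integrable fun x => (1 - 5 * φ x) * pd h s x * (u2 x * s x)
        - (1 - 5 * φ x) * w x * (u2 x * pd h a x) := I6.sub I5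
    rw [t1, neg_add_eq_sub, ← integral_sub I6 I5, ← integral_add I65 I7]
    congr 1; funext x
    simp only [← hs, ← hw]
    ring
  have e2 : ∫ x, φ x * s x * w x * pd h u x =
      -(∫ x, κ x * u x * w x * (pd h a x * s x))
      + (∫ x, κ x * u x * pd h s x * (s x * s x))
      + ∫ x, φ x * pd h s x * (u2 x * s x) := by
    have I98 : Integrable fun x => κ x * u x * pd h s x * (s x * s x)
        - κ x * u x * w x * (pd h a x * s x) := I9.sub I8
    rw [t2, neg_add_eq_sub, ← integral_sub I9 I8, ← integral_add I98 I10]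
    congr 1; funext x
    simp only [← hs, ← hw, ← hu2]
    ring
  have hR : hRem φ κ ψ V h = fun x =>
      -(κ x * u x * pd h ψ x * w x * w x) - 2 * (φ x * pd h ψ x * w x * pd 2 u2 x)
      - 6 * (φ x * w x * (u2 x * pd h a x)) - 6 * (φ x * u x * w x * pd h s x)
      + 2 * (φ x * (1 + a x) * w x * pd h u2 x) + 6 * (φ x * s x * w x * pd h u x) := by
    funext x
    simp only [hRem, ← ha, ← hs, ← hw, ← hu, ← hu2]
    ring
  have F0 : Integrable fun x => -(κ x * u x * pd h ψ x * w x * w x) := I1.neg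
  have F1 := F0.sub (I2.const_mul 2)
  have F2 := F1.sub (I3.const_mul 6)
  have F3 := F2.sub (I4.const_mul 6)
  have F4 := F3.add (J1.const_mul 2)
  have F5 := F4.add (J2.const_mul 6)
  have hint : ∫ x, hRem φ κ ψ V h x =
      -(∫ x, κ x * u x * pd h ψ x * w x * w x) - 2 * (∫ x, φ x * pd h ψ x * w x * pd 2 u2 x)
      - 6 * (∫ x, φ x * w x * (u2 x * pd h a x)) - 6 * (∫ x, φ x * u x * w x * pd h s x)
      + 2 * (∫ x, φ x * (1 + a x) * w x * pd h u2 x)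
      + 6 * (∫ x, φ x * s x * w x * pd h u x) := by
    rw [hR]
    refine (integral_add F4 (J2.const_mul 6)).trans ?_
    refine congr_arg₂ _ ((integral_add F3 (J1.const_mul 2)).trans ?_) (integral_const_mul _ _)
    refine congr_arg₂ _ ((integral_sub F2 (I4.const_mul 6)).trans ?_) (integral_const_mul _ _)
    refine congr_arg₂ _ ((integral_sub F1 (I3.const_mul 6)).trans ?_) (integral_const_mul _ _)
    refine congr_arg₂ _ ((integral_sub F0 (I2.const_mul 2)).trans ?_) (integral_const_mul _ _)
    exact congr_arg₂ _ (integral_neg _) (integral_const_mul _ _)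
  refine ⟨hR ▸ F5, ?_⟩
  rw [hint, e1, e2]
  have B1 := abs_le.1 (abs_integral_le_integral_abs.trans E1)
  have B2 := abs_le.1 (abs_integral_le_integral_abs.trans E2)
  have B3 := abs_le.1 (abs_integral_le_integral_abs.trans E3)
  have B4 := abs_le.1 (abs_integral_le_integral_abs.trans E4)
  have B5 := abs_le.1 (abs_integral_le_integral_abs.trans E5)
  have B6 := abs_le.1 (abs_integral_le_integral_abs.trans E6)
  have B7 := abs_le.1 (abs_integral_le_integral_abs.trans E7)
  have B8 := abs_le.1 (abs_integral_le_integral_abs.trans E8)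
  have B9 := abs_le.1 (abs_integral_le_integral_abs.trans E9)
  have B10 := abs_le.1 (abs_integral_le_integral_abs.trans E10)
  rw [abs_le]
  constructor <;> linarith [B1.1, B1.2, B2.1, B2.2, B3.1, B3.2, B4.1, B4.2, B5.1, B5.2, B6.1, B6.2,
    B7.1, B7.2, B8.1, B8.2, B9.1, B9.2, B10.1, B10.2]

lemma n2_le_of_sq {f : Pt → ℝ} {c : ℝ} (hc : 0 ≤ c) (h : l2Sq f ≤ c ^ 2) : n2 f ≤ c := by
  rw [n2]; exact Real.sqrt_le_iff.2 ⟨hc, h⟩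

lemma h1_le_of_sq {f : Pt → ℝ} {c : ℝ} (hc : 0 ≤ c) (h : hSq 1 f ≤ c ^ 2) : h1 f ≤ c := by
  rw [h1]; exact Real.sqrt_le_iff.2 ⟨hc, h⟩

lemma hSq_pd_le_gradHSq (k : ℕ) (f : Pt → ℝ) (i : Fin 3) : hSq k (pd i f) ≤ gradHSq k f :=
  Finset.single_le_sum (f := fun i => hSq k (pd i f)) (fun _ _ => hSq_nonneg _ _)
    (Finset.mem_univ i)

lemma hSq_pd_pd_le_gradHHSq (k : ℕ) (f : Pt → ℝ) {i : Fin 3} (hi : i ∈ hIdx) (j : Fin 3) :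
    hSq k (pd i (pd j f)) ≤ gradHHSq k f :=
  (Finset.single_le_sum (f := fun j => hSq k (pd i (pd j f))) (fun _ _ => hSq_nonneg _ _)
    (Finset.mem_univ j)).trans
  (Finset.single_le_sum (f := fun i => ∑ j, hSq k (pd i (pd j f)))
    (fun _ _ => Finset.sum_nonneg fun _ _ => hSq_nonneg _ _) hi)

lemma gradHSq_one_pd_le {f : Pt → ℝ} (hf : IsSchwartz f) (j : Fin 3) :
    gradHSq 1 (pd j f) ≤ 4 * gradHSq 2 f := by
  rw [gradHSq, gradHSq, Finset.mul_sum]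
  refine Finset.sum_le_sum fun i _ => ?_
  rw [pd_comm hf.1 i j]
  exact hSq_one_pd_le (hf.pd i).1 j

lemma gradHSq_one_horizontal_le {f : Pt → ℝ} (hf : IsSchwartz f) {h : Fin 3} (hh : h ∈ hIdx) :
    gradHSq 1 (pd h f) ≤ gradHHSq 1 f := by
  have : gradHSq 1 (pd h f) = ∑ j, hSq 1 (pd h (pd j f)) :=
    Finset.sum_congr rfl fun i _ => by rw [pd_comm hf.1 i h]
  rw [this]
  exact Finset.single_le_sum (f := fun i => ∑ j, hSq 1 (pd i (pd j f)))
    (fun _ _ => Finset.sum_nonneg fun _ _ => hSq_nonneg _ _) hh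

/-- `∫ |hRem|` in terms of norms of the factors. -/
lemma integral_abs_hRem_le {φ κ ψ V : Pt → ℝ} {h : Fin 3} (hψ : IsSchwartz ψ) (hV : IsSchwartz V)
    (hφ : Continuous φ) (hκ : Continuous κ) {Φ K Φ' U A P X₁ X₂ : ℝ}
    (bφ : ∀ x, |φ x| ≤ Φ) (bκ : ∀ x, |κ x| ≤ K)
    (bφ' : ∀ x, |φ x * (1 + pd 2 ψ x)| ≤ Φ')
    (bu : ∀ x, |pd 2 V x| ≤ U) (bψ : ∀ x, |pd h ψ x| ≤ U)
    (bw : n2 (pd 2 (pd 2 (pd 2 ψ))) ≤ A) (bs : n2 (pd h (pd 2 (pd 2 ψ))) ≤ P)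
    (bu3 : n2 (pd 2 (pd 2 (pd 2 V))) ≤ P) (bu3h : n2 (pd h (pd 2 (pd 2 V))) ≤ P)
    (b1 : n2 (fun x => pd 2 (pd 2 V) x * pd h (pd 2 ψ) x) ≤ X₁)
    (b2 : n2 (fun x => pd 2 (pd 2 ψ) x * pd h (pd 2 V) x) ≤ X₂) :
    ∫ x, |hRem φ κ ψ V h x| ≤ K * U * U * (A * A) + 2 * (Φ * U * (A * P)) + 6 * (Φ * (A * X₁))
      + 6 * (Φ * U * (A * P)) + 2 * (Φ' * (A * P)) + 6 * (Φ * (A * X₂)) := by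
  set a := pd 2 ψ with ha
  set s := pd 2 a with hs
  set w := pd 2 s with hw
  set u := pd 2 V with hu
  set u2 := pd 2 u with hu2
  have Sa : IsSchwartz a := hψ.pd 2
  have Ss : IsSchwartz s := Sa.pd 2
  have Sw : IsSchwartz w := Ss.pd 2
  have Su : IsSchwartz u := hV.pd 2
  have Su2 : IsSchwartz u2 := Su.pd 2
  have c1 : Continuous fun x => κ x * u x * pd h ψ x :=
    (hκ.mul Su.continuous).mul (hψ.pd h).continuous
  have c2 : Continuous fun x => φ x * pd h ψ x := hφ.mul (hψ.pd h).continuous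
  have c3 : Continuous fun x => φ x * u x := hφ.mul Su.continuous
  have c5 : Continuous fun x => φ x * (1 + a x) := hφ.mul (continuous_const.add Sa.continuous)
  have m1 : ∀ x, |κ x * u x * pd h ψ x| ≤ K * U * U := fun x => by
    have := (abs_nonneg _).trans (bκ x)
    have := (abs_nonneg _).trans (bu x)
    rw [abs_mul, abs_mul]; gcongr <;> simp_all
  have m2 : ∀ x, |φ x * pd h ψ x| ≤ Φ * U := fun x => by
    have := (abs_nonneg _).trans (bφ x)
    rw [abs_mul]; gcongr <;> simp_all
  have m3 : ∀ x, |φ x * u x| ≤ Φ * U := fun x => by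
    have := (abs_nonneg _).trans (bφ x)
    rw [abs_mul]; gcongr <;> simp_all
  have Lw := Sw.memLp 2
  obtain ⟨I1, E1⟩ := integrable_and_abs_integral_le c1 m1 Lw Lw bw bw
  obtain ⟨I2, E2⟩ := integrable_and_abs_integral_le c2 m2 Lw ((Su2.pd 2).memLp 2) bw bu3
  obtain ⟨I3, E3⟩ := integrable_and_abs_integral_le hφ bφ Lw
    ((Su2.mul (Sa.pd h)).memLp 2) bw b1
  obtain ⟨I4, E4⟩ := integrable_and_abs_integral_le c3 m3 Lw ((Ss.pd h).memLp 2) bw bs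
  obtain ⟨I5, E5⟩ := integrable_and_abs_integral_le c5 bφ' Lw ((Su2.pd h).memLp 2) bw bu3h
  obtain ⟨I6, E6⟩ := integrable_and_abs_integral_le hφ bφ Lw
    ((Ss.mul (Su.pd h)).memLp 2) bw b2
  have F2 := I1.abs.add (I2.abs.const_mul 2)
  have F3 := F2.add (I3.abs.const_mul 6)
  have F4 := F3.add (I4.abs.const_mul 6)
  have F5 := F4.add (I5.abs.const_mul 2)
  have F6 := F5.add (I6.abs.const_mul 6)
  have hint := (integral_add F5 (I6.abs.const_mul 6)).trans <|
    congr_arg₂ _ ((integral_add F4 (I5.abs.const_mul 2)).trans <|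
    congr_arg₂ _ ((integral_add F3 (I4.abs.const_mul 6)).trans <|
    congr_arg₂ _ ((integral_add F2 (I3.abs.const_mul 6)).trans <|
    congr_arg₂ _ ((integral_add I1.abs (I2.abs.const_mul 2)).trans <|
      congr_arg₂ _ rfl (integral_const_mul _ _))
      (integral_const_mul _ _)) (integral_const_mul _ _)) (integral_const_mul _ _))
      (integral_const_mul _ _)
  refine (integral_mono_of_nonneg (ae_of_all _ fun _ => abs_nonneg _) F6
    (ae_of_all _ fun x => ?_)).trans (hint.le.trans ?_)
  · simp only [Pi.add_apply]
    have hR : hRem φ κ ψ V h x =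
        -(κ x * u x * pd h ψ x * w x * w x) - 2 * (φ x * pd h ψ x * w x * pd 2 u2 x)
        - 6 * (φ x * w x * (u2 x * pd h a x)) - 6 * (φ x * u x * w x * pd h s x)
        + 2 * (φ x * (1 + a x) * w x * pd h u2 x) + 6 * (φ x * w x * (s x * pd h u x)) := by
      simp only [hRem, ← ha, ← hs, ← hw, ← hu, ← hu2]
      ring
    rw [hR, abs_le]
    have q1 := neg_abs_le (κ x * u x * pd h ψ x * w x * w x)
    have q2 := neg_abs_le (φ x * pd h ψ x * w x * pd 2 u2 x)
    have q3 := neg_abs_le (φ x * w x * (u2 x * pd h a x))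
    have q4 := neg_abs_le (φ x * u x * w x * pd h s x)
    have q5 := neg_abs_le (φ x * (1 + a x) * w x * pd h u2 x)
    have q6 := neg_abs_le (φ x * w x * (s x * pd h u x))
    have r1 := le_abs_self (κ x * u x * pd h ψ x * w x * w x)
    have r2 := le_abs_self (φ x * pd h ψ x * w x * pd 2 u2 x)
    have r3 := le_abs_self (φ x * w x * (u2 x * pd h a x))
    have r4 := le_abs_self (φ x * u x * w x * pd h s x)
    have r5 := le_abs_self (φ x * (1 + a x) * w x * pd h u2 x)
    have r6 := le_abs_self (φ x * w x * (s x * pd h u x))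
    constructor <;> linarith
  · linarith

/-- Fixed-time estimates for `∂₃ψ`, `∂₃V` and the horizontal remainder. -/
lemma exists_fixed_time_bounds : ∃ C : ℝ, 0 < C ∧
    (∀ ψ, IsSchwartz ψ → ∀ A, 0 ≤ A → gradHSq 2 ψ ≤ A ^ 2 → ∀ x, |pd 2 ψ x| ≤ C * A) ∧
    ∀ ψ V, IsSchwartz ψ → IsSchwartz V → ∀ h ∈ hIdx, ∀ A P, 0 ≤ A → 0 ≤ P →
      gradHSq 2 ψ ≤ A ^ 2 → gradHSq 2 V ≤ P ^ 2 → gradHHSq 1 ψ ≤ P ^ 2 →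
      ∀ (φ κ : Pt → ℝ) (Φ K Φ' K' : ℝ), Differentiable ℝ φ → Continuous κ →
      (∀ i x, pd i φ x = κ x * pd i (pd 2 ψ) x) →
      (∀ x, κ x * (1 + pd 2 ψ x) + 6 * φ x = 1) →
      (∀ x, |φ x| ≤ Φ) → (∀ x, |κ x| ≤ K) →
      (∀ x, |φ x * (1 + pd 2 ψ x)| ≤ Φ') → (∀ x, |1 - 5 * φ x| ≤ K') →
      Integrable (hRem φ κ ψ V h) ∧
      |∫ x, hRem φ κ ψ V h x| ≤ C * (P ^ 2 * (K * A ^ 2 + Φ * A + K' * A + Φ')) ∧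
      ∫ x, |hRem φ κ ψ V h x| ≤ C * (P ^ 2 * (K * A ^ 2 + Φ * A) + Φ' * A * P + Φ * A ^ 2 * P) := by
  obtain ⟨c, hc, Hc⟩ := exists_abs_le_gradient
  obtain ⟨d, hd, Hd⟩ := exists_n2_mul_le
  have key : ∀ f, IsSchwartz f → ∀ A, 0 ≤ A → gradHSq 2 f ≤ A ^ 2 → ∀ j x,
      |pd j f x| ≤ c * (2 * A) := by
    intro f hf A hA hfA j x
    refine (Hc _ (hf.pd j) x).trans (mul_le_mul_of_nonneg_left ?_ hc.le)
    refine Real.sqrt_le_iff.2 ⟨by positivity, (gradHSq_one_pd_le hf j).trans ?_⟩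
    nlinarith
  refine ⟨4 * c ^ 2 + 16 * c + 60 * d + 2 + 72 * c * d, by positivity, ?_, ?_⟩
  · intro ψ hψ A hA hψA x
    refine (key ψ hψ A hA hψA 2 x).trans ?_
    have : 0 ≤ c ^ 2 * A := by positivity
    have : 0 ≤ c * A := by positivity
    have : 0 ≤ d * A := by positivity
    have : 0 ≤ c * d * A := by positivity
    nlinarith
  intro ψ V hψ hV h hh A P hA hP hψA hVP hψP φ κ Φ K Φ' K' hφ hκ hφd hode bφ bκ bφ' bκ'
  have hu : ∀ x, |pd 2 V x| ≤ c * (2 * P) := key V hV P hP hVP 2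
  have hψh : ∀ x, |pd h ψ x| ≤ c * (2 * P) := fun x => by
    refine (Hc _ (hψ.pd h) x).trans (mul_le_mul_of_nonneg_left ?_ hc.le)
    refine Real.sqrt_le_iff.2 ⟨by positivity, (gradHSq_one_horizontal_le hψ hh).trans ?_⟩
    nlinarith
  have bw : n2 (pd 2 (pd 2 (pd 2 ψ))) ≤ A := n2_le_of_sq hA <|
    (l2Sq_pd_pd_le_hSq (hψ.pd 2).1 2 2).trans ((hSq_pd_le_gradHSq 2 ψ 2).trans hψA)
  have bs : n2 (pd h (pd 2 (pd 2 ψ))) ≤ P := n2_le_of_sq hP <| by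
    rw [pd_comm (hψ.pd 2).1]
    exact (l2Sq_pd_le_hSq le_rfl _ _).trans ((hSq_pd_pd_le_gradHHSq 1 ψ hh 2).trans hψP)
  have bV : ∀ i, n2 (pd i (pd 2 (pd 2 V))) ≤ P := fun i => n2_le_of_sq hP <|
    (l2Sq_pd_pd_le_hSq (hV.pd 2).1 i 2).trans ((hSq_pd_le_gradHSq 2 V 2).trans hVP)
  have bVi : ∀ i, h1 (pd i (pd 2 V)) ≤ 2 * P := fun i => h1_le_of_sq (by positivity) <| by
    have := hSq_one_pd_le (hV.pd 2).1 i
    have := (hSq_pd_le_gradHSq 2 V 2).trans hVP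
    nlinarith
  have bs1 : h1 (pd 2 (pd 2 ψ)) ≤ 2 * A := h1_le_of_sq (by positivity) <| by
    have := hSq_one_pd_le (hψ.pd 2).1 2
    have := (hSq_pd_le_gradHSq 2 ψ 2).trans hψA
    nlinarith
  have bah : h1 (pd h (pd 2 ψ)) ≤ P := h1_le_of_sq hP <|
    (hSq_pd_pd_le_gradHHSq 1 ψ hh 2).trans hψP
  have prod : ∀ {f g : Pt → ℝ} {x y : ℝ}, IsSchwartz f → IsSchwartz g → h1 f ≤ x → h1 g ≤ y →
      n2 (fun z => f z * g z) ≤ d * x * y := fun {f g x y} hf hg hx hy => by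
    refine (Hd f g hf hg).trans ?_
    have := h1_nonneg f
    have := h1_nonneg g
    have : 0 ≤ x := by linarith
    gcongr
  have Sa := hψ.pd 2
  have Ss := Sa.pd 2
  have Su := hV.pd 2
  have Su2 := Su.pd 2
  have b1 := prod Su2 (Sa.pd h) (bVi 2) bah
  obtain ⟨I, E⟩ := abs_integral_hRem_le hψ hV hφ hκ hφd hode bφ bκ bφ' bκ' hu hψh bw bs (bV 2)
    b1 (prod Su2 Ss (bVi 2) bs1) (prod (Sa.pd h) Ss bah bs1) (prod Ss Ss bs1 bs1)
  have E' := integral_abs_hRem_le hψ hV hφ.continuous hκ bφ bκ bφ' hu hψh bw bs (bV 2) (bV h) b1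
    (prod Ss (Su.pd h) bs1 (bVi h))
  have pΦ := (abs_nonneg _).trans (bφ 0)
  have pK := (abs_nonneg _).trans (bκ 0)
  have pΦ' := (abs_nonneg _).trans (bφ' 0)
  have pK' := (abs_nonneg _).trans (bκ' 0)
  have k1 : 0 ≤ P ^ 2 * (K * A ^ 2) := by positivity
  have k2 : 0 ≤ P ^ 2 * (Φ * A) := by positivity
  have k3 : 0 ≤ P ^ 2 * (K' * A) := by positivity
  have k4 : 0 ≤ P ^ 2 * Φ' := by positivity
  have k5 : 0 ≤ Φ' * A * P := by positivity
  have k6 : 0 ≤ Φ * A ^ 2 * P := by positivity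
  have l1 : 0 ≤ c ^ 2 := by positivity
  have l2 : 0 ≤ c * d := by positivity
  refine ⟨I, E.trans ?_, E'.trans ?_⟩
  · linarith [mul_nonneg hc.le k1, mul_nonneg hc.le k2, mul_nonneg hc.le k3, mul_nonneg hc.le k4,
      mul_nonneg hd.le k1, mul_nonneg hd.le k2, mul_nonneg hd.le k3, mul_nonneg hd.le k4,
      mul_nonneg l1 k1, mul_nonneg l1 k2, mul_nonneg l1 k3, mul_nonneg l1 k4,
      mul_nonneg l2 k1, mul_nonneg l2 k2, mul_nonneg l2 k3, mul_nonneg l2 k4]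
  · linarith [mul_nonneg hc.le k1, mul_nonneg hc.le k2, mul_nonneg hc.le k5,
      mul_nonneg hd.le k1, mul_nonneg hd.le k2, mul_nonneg hd.le k5,
      mul_nonneg l1 k1, mul_nonneg l1 k2, mul_nonneg l1 k5,
      mul_nonneg l2 k1, mul_nonneg l2 k2, mul_nonneg l2 k5,
      mul_nonneg hc.le k6, mul_nonneg hd.le k6, mul_nonneg l1 k6, mul_nonneg l2 k6]

section Slab

variable {s : Set ℝ} {f : ℝ → Pt → ℝ} {t : ℝ}

lemma SmoothOn2.hasFDerivAt (hs : IsOpen s) (hf : SmoothOn2 s f) (ht : t ∈ s) (x : Pt) :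
    HasFDerivAt (fun q : ℝ × Pt => f q.1 q.2) (fderiv ℝ (fun q : ℝ × Pt => f q.1 q.2) (t, x))
      (t, x) := by
  have hn : s ×ˢ (univ : Set Pt) ∈ nhds (t, x) := (hs.prod isOpen_univ).mem_nhds ⟨ht, mem_univ _⟩
  exact ((hf.contDiffAt hn).differentiableAt (by simp)).hasFDerivAt

lemma SmoothOn2.slice (hf : SmoothOn2 s f) (ht : t ∈ s) : ContDiff ℝ (⊤ : ℕ∞) (f t) := by
  rw [← contDiffOn_univ]
  exact hf.comp (g := fun q : ℝ × Pt => f q.1 q.2) (f := fun x : Pt => (t, x))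
    (contDiff_prodMk_right t).contDiffOn fun x _ => ⟨ht, mem_univ _⟩

lemma SmoothOn2.pd_eq (hs : IsOpen s) (hf : SmoothOn2 s f) (ht : t ∈ s) (i : Fin 3) (x : Pt) :
    pd i (f t) x = fderiv ℝ (fun q : ℝ × Pt => f q.1 q.2) (t, x) (0, Pi.single i 1) := by
  have h : HasFDerivAt (f t) _ x :=
    (hf.hasFDerivAt hs ht x).comp x (hasFDerivAt_prodMk_right t x)
  rw [pd, h.fderiv]
  simp

lemma SmoothOn2.hasDerivAt (hs : IsOpen s) (hf : SmoothOn2 s f) (ht : t ∈ s) (x : Pt) :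
    HasDerivAt (fun τ => f τ x) (fderiv ℝ (fun q : ℝ × Pt => f q.1 q.2) (t, x) (1, 0)) t := by
  have h := ((hf.hasFDerivAt hs ht x).comp (f := fun τ : ℝ => (τ, x)) t
    (hasFDerivAt_prodMk_left t x)).hasDerivAt
  exact h

lemma SmoothOn2.pd (hs : IsOpen s) (hf : SmoothOn2 s f) (i : Fin 3) :
    SmoothOn2 s fun t => pd i (f t) :=
  (hf.fderiv_apply_const (hs.prod isOpen_univ) (0, Pi.single i 1)).congr fun q hq =>
    hf.pd_eq hs hq.1 i q.2

lemma SmoothOn2.deriv (hs : IsOpen s) (hf : SmoothOn2 s f) :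
    SmoothOn2 s fun t x => deriv (fun τ => f τ x) t :=
  (hf.fderiv_apply_const (hs.prod isOpen_univ) (1, 0)).congr fun q hq =>
    (hf.hasDerivAt hs hq.1 q.2).deriv

lemma SmoothOn2.deriv_pd (hs : IsOpen s) (hf : SmoothOn2 s f) (ht : t ∈ s) (i : Fin 3) (x : Pt) :
    _root_.deriv (fun τ => _root_.pd i (f τ) x) t =
      _root_.pd i (fun y => _root_.deriv (fun τ => f τ y) t) x := by
  have hU : IsOpen (s ×ˢ (univ : Set Pt)) := hs.prod isOpen_univ
  have hq : (t, x) ∈ s ×ˢ (univ : Set Pt) := ⟨ht, mem_univ _⟩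
  have hn := hU.mem_nhds hq
  rw [((hf.pd hs i).hasDerivAt hs ht x).deriv, (hf.deriv hs).pd_eq hs ht i x]
  have e1 : (fun q : ℝ × Pt => _root_.pd i (f q.1) q.2) =ᶠ[nhds (t, x)]
      fun q => fderiv ℝ (fun q : ℝ × Pt => f q.1 q.2) q (0, Pi.single i 1) :=
    Filter.eventually_of_mem hn fun q hq => hf.pd_eq hs hq.1 i q.2
  have e2 : (fun q : ℝ × Pt => _root_.deriv (fun τ => f τ q.2) q.1) =ᶠ[nhds (t, x)]
      fun q => fderiv ℝ (fun q : ℝ × Pt => f q.1 q.2) q (1, 0) :=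
    Filter.eventually_of_mem hn fun q hq => (hf.hasDerivAt hs hq.1 q.2).deriv
  rw [e1.fderiv_eq, e2.fderiv_eq]
  exact fderiv_fderiv_apply_comm hU hf _ _ hq

/-- The material derivative `∂_t f + v·∇f`. -/
def mat (v : Fin 3 → ℝ → Pt → ℝ) (f : ℝ → Pt → ℝ) (t : ℝ) (x : Pt) : ℝ :=
  deriv (fun τ => f τ x) t + ∑ i, v i t x * pd i (f t) x

lemma mat_pd {v : Fin 3 → ℝ → Pt → ℝ} (hs : IsOpen s) (hf : SmoothOn2 s f) (ht : t ∈ s)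
    (hv : ∀ i, Differentiable ℝ (v i t)) (j : Fin 3) (x : Pt) :
    mat v (fun τ => pd j (f τ)) t x =
      pd j (mat v f t) x - ∑ i, pd j (v i t) x * pd i (f t) x := by
  have h1 : Differentiable ℝ fun y => deriv (fun τ => f τ y) t :=
    ((hf.deriv hs).slice ht).differentiable (by simp)
  have h2 : ∀ i, Differentiable ℝ (pd i (f t)) := fun i =>
    ((hf.pd hs i).slice ht).differentiable (by simp)
  have h3 : pd j (mat v f t) x = pd j (fun y => deriv (fun τ => f τ y) t) x +
      ∑ i, (v i t x * pd j (pd i (f t)) x + pd i (f t) x * pd j (v i t) x) := by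
    have := ((h1 x).hasFDerivAt.add (HasFDerivAt.fun_sum (u := Finset.univ) fun i _ =>
      (hv i x).hasFDerivAt.mul (h2 i x).hasFDerivAt)).fderiv
    refine (congr_arg (fun L => L (Pi.single j 1)) this).trans ?_
    simp [pd]
  rw [h3, mat, hf.deriv_pd hs ht, add_sub_assoc, ← Finset.sum_sub_distrib]
  congr 1
  refine Finset.sum_congr rfl fun i _ => ?_
  rw [pd_comm (hf.slice ht) j i]
  ring

end Slab

lemma pd_neg_sub_sum_sub_sum {f : Pt → ℝ} {p q p' q' : Fin 3 → Pt → ℝ} (hf : Differentiable ℝ f)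
    (hp : ∀ i, Differentiable ℝ (p i)) (hq : ∀ i, Differentiable ℝ (q i))
    (hp' : ∀ i, Differentiable ℝ (p' i)) (hq' : ∀ i, Differentiable ℝ (q' i)) (c : ℝ) (j : Fin 3)
    (x : Pt) :
    pd j (fun x => -f x - (∑ i, p i x * q i x) - c * ∑ i, p' i x * q' i x) x =
      -pd j f x - (∑ i, (p i x * pd j (q i) x + q i x * pd j (p i) x))
        - c * ∑ i, (p' i x * pd j (q' i) x + q' i x * pd j (p' i) x) := by
  have := (((hf x).hasFDerivAt.neg.sub (HasFDerivAt.fun_sum (u := Finset.univ) fun i _ =>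
      (hp i x).hasFDerivAt.mul (hq i x).hasFDerivAt)).sub
      ((HasFDerivAt.fun_sum (u := Finset.univ) fun i _ =>
      (hp' i x).hasFDerivAt.mul (hq' i x).hasFDerivAt).const_mul c)).fderiv
  refine (congr_arg (fun L => L (Pi.single j 1)) this).trans ?_
  simp [pd]

section Transport

variable {s : Set ℝ} {ψ : ℝ → Pt → ℝ} {v : Fin 3 → ℝ → Pt → ℝ} {t : ℝ}

lemma TransportEq.mat_eq (hψ : TransportEq s ψ v) (ht : t ∈ s) : mat v ψ t = fun x => -v 2 t x :=
  funext fun x => eq_neg_of_add_eq_zero_left (hψ t ht x)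

lemma TransportEq.mat_pd_eq (hs : IsOpen s) (hψ : TransportEq s ψ v) (sψ : SmoothOn2 s ψ)
    (sv : ∀ i, SmoothOn2 s (v i)) (ht : t ∈ s) :
    mat v (fun τ => pd 2 (ψ τ)) t = fun x =>
      -pd 2 (v 2 t) x - ∑ i, pd 2 (v i t) x * pd i (ψ t) x := by
  funext x
  rw [mat_pd hs sψ ht (fun i => ((sv i).slice ht).differentiable (by simp)), hψ.mat_eq ht]
  rw [pd_neg]

lemma TransportEq.mat_pd_pd_eq (hs : IsOpen s) (hψ : TransportEq s ψ v) (sψ : SmoothOn2 s ψ)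
    (sv : ∀ i, SmoothOn2 s (v i)) (ht : t ∈ s) :
    mat v (fun τ => pd 2 (pd 2 (ψ τ))) t = fun x =>
      -pd 2 (pd 2 (v 2 t)) x - (∑ i, pd 2 (pd 2 (v i t)) x * pd i (ψ t) x)
        - 2 * ∑ i, pd 2 (v i t) x * pd i (pd 2 (ψ t)) x := by
  funext x
  rw [mat_pd hs (sψ.pd hs 2) ht (fun i => ((sv i).slice ht).differentiable (by simp)),
    hψ.mat_pd_eq hs sψ sv ht]
  have d1 : ∀ i, Differentiable ℝ (pd 2 (v i t)) := fun i =>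
    (((sv i).pd hs 2).slice ht).differentiable (by simp)
  have d2 : ∀ i, Differentiable ℝ (pd i (ψ t)) := fun i =>
    ((sψ.pd hs i).slice ht).differentiable (by simp)
  have := pd_neg_sub_sum_sub_sum (d1 2) d1 d2 d1 d2 0 2 x
  simp only [zero_mul, sub_zero] at this
  rw [this]
  simp only [Fin.sum_univ_three, pd_comm (sψ.slice ht) 2]
  ring

lemma TransportEq.mat_pd_pd_pd_eq (hs : IsOpen s) (hψ : TransportEq s ψ v) (sψ : SmoothOn2 s ψ)
    (sv : ∀ i, SmoothOn2 s (v i)) (ht : t ∈ s) (x : Pt) :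
    mat v (fun τ => pd 2 (pd 2 (pd 2 (ψ τ)))) t x =
      -pd 2 (pd 2 (pd 2 (v 2 t))) x - (∑ i, pd 2 (pd 2 (pd 2 (v i t))) x * pd i (ψ t) x)
        - 3 * (∑ i, pd 2 (pd 2 (v i t)) x * pd i (pd 2 (ψ t)) x)
        - 3 * ∑ i, pd 2 (v i t) x * pd i (pd 2 (pd 2 (ψ t))) x := by
  rw [mat_pd hs ((sψ.pd hs 2).pd hs 2) ht (fun i => ((sv i).slice ht).differentiable (by simp)),
    hψ.mat_pd_pd_eq hs sψ sv ht]
  have d1 : ∀ i, Differentiable ℝ (pd 2 (v i t)) := fun i =>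
    (((sv i).pd hs 2).slice ht).differentiable (by simp)
  have d1' : ∀ i, Differentiable ℝ (pd 2 (pd 2 (v i t))) := fun i =>
    ((((sv i).pd hs 2).pd hs 2).slice ht).differentiable (by simp)
  have d2 : ∀ i, Differentiable ℝ (pd i (ψ t)) := fun i =>
    ((sψ.pd hs i).slice ht).differentiable (by simp)
  have d3 : ∀ i, Differentiable ℝ (pd i (pd 2 (ψ t))) := fun i =>
    (((sψ.pd hs 2).pd hs i).slice ht).differentiable (by simp)
  rw [pd_neg_sub_sum_sub_sum (d1' 2) d1' d2 d1 d3]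
  have e1 : ∀ i, pd 2 (pd i (ψ t)) = pd i (pd 2 (ψ t)) := fun i => pd_comm (sψ.slice ht) 2 i
  have e2 : ∀ i, pd 2 (pd i (pd 2 (ψ t))) = pd i (pd 2 (pd 2 (ψ t))) := fun i =>
    pd_comm ((sψ.pd hs 2).slice ht) 2 i
  simp only [Fin.sum_univ_three, e1, e2]
  ring

end Transport

lemma DivFree.pd {s : Set ℝ} {v : Fin 3 → ℝ → Pt → ℝ}
    (hv : ∀ t ∈ s, ∀ i, ContDiff ℝ (⊤ : ℕ∞) (v i t)) (h : DivFree s v) (j : Fin 3) :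
    DivFree s fun i t => pd j (v i t) := by
  intro t ht x
  have hd : ∀ i, Differentiable ℝ (_root_.pd i (v i t)) := fun i =>
    (contDiffOn_univ.1 ((hv t ht i).contDiffOn.fderiv_apply_const isOpen_univ
      (Pi.single i 1))).differentiable (by simp)
  have h0 : (fun x => ∑ i, _root_.pd i (v i t) x) = fun _ => 0 := funext (h t ht)
  have h1 : _root_.pd j (fun x => ∑ i, _root_.pd i (v i t) x) x = 0 := by
    rw [h0]; simp [_root_.pd]
  have h2 := (HasFDerivAt.fun_sum (u := Finset.univ) fun i _ => (hd i x).hasFDerivAt).fderiv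
  rw [_root_.pd, h2] at h1
  simp only [sum_apply] at h1
  rw [← h1]
  exact Finset.sum_congr rfl fun i _ => congr_fun (pd_comm (hv t ht i) i j) x

section Slab

variable {s : Set ℝ} {p q : ℝ → Pt → ℝ} {t : ℝ}

lemma SmoothOn2.mul (hp : SmoothOn2 s p) (hq : SmoothOn2 s q) :
    SmoothOn2 s fun t x => p t x * q t x :=
  ContDiffOn.mul hp hq

lemma SmoothOn2.comp {g : ℝ → ℝ} {S : Set ℝ} (hg : ContDiffOn ℝ (⊤ : ℕ∞) g S)
    (hp : SmoothOn2 s p) (hS : ∀ t ∈ s, ∀ x, p t x ∈ S) : SmoothOn2 s fun t x => g (p t x) :=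
  ContDiffOn.comp hg hp fun q hq => hS q.1 hq.1 q.2

lemma mat_mul {v : Fin 3 → ℝ → Pt → ℝ} (hs : IsOpen s) (hp : SmoothOn2 s p) (hq : SmoothOn2 s q)
    (ht : t ∈ s) (x : Pt) :
    mat v (fun t x => p t x * q t x) t x = mat v p t x * q t x + p t x * mat v q t x := by
  have h1 := ((hp.hasDerivAt hs ht x).mul (hq.hasDerivAt hs ht x)).deriv
  rw [← (hp.hasDerivAt hs ht x).deriv, ← (hq.hasDerivAt hs ht x).deriv] at h1
  have h2 : ∀ i, pd i (fun x => p t x * q t x) = _ := fun i =>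
    pd_mul ((hp.slice ht).differentiable (by simp)) ((hq.slice ht).differentiable (by simp)) i
  have h3 : deriv (fun τ => p τ x * q τ x) t = _ := h1
  simp only [mat, h2, h3, Fin.sum_univ_three]
  ring

lemma pd_comp {g : ℝ → ℝ} {f : Pt → ℝ} {x : Pt} (hg : DifferentiableAt ℝ g (f x))
    (hf : Differentiable ℝ f) (i : Fin 3) :
    pd i (fun x => g (f x)) x = deriv g (f x) * pd i f x := by
  have : HasFDerivAt (fun x => g (f x)) _ x := hg.hasDerivAt.comp_hasFDerivAt x (hf x).hasFDerivAt
  rw [pd, this.fderiv]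
  simp [pd]

lemma mat_comp {v : Fin 3 → ℝ → Pt → ℝ} {g : ℝ → ℝ} (hs : IsOpen s) (hp : SmoothOn2 s p)
    (ht : t ∈ s) (x : Pt) (hg : DifferentiableAt ℝ g (p t x)) :
    mat v (fun t x => g (p t x)) t x = deriv g (p t x) * mat v p t x := by
  have h1 : HasDerivAt (fun τ => g (p τ x)) _ t :=
    HasDerivAt.comp (h := fun τ => p τ x) t hg.hasDerivAt (hp.hasDerivAt hs ht x)
  simp only [mat, h1.deriv, (hp.hasDerivAt hs ht x).deriv,
    pd_comp hg ((hp.slice ht).differentiable (by simp)), Fin.sum_univ_three]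
  ring

end Slab

/-- The density `g(∂₃ψ) (∂₃³ψ)²`. -/
def density (g : ℝ → ℝ) (ψ : ℝ → Pt → ℝ) (t : ℝ) (x : Pt) : ℝ :=
  g (pd 2 (ψ t) x) * (pd 2 (pd 2 (pd 2 (ψ t))) x * pd 2 (pd 2 (pd 2 (ψ t))) x)

lemma smoothOn2_density {s S : Set ℝ} {g : ℝ → ℝ} {ψ : ℝ → Pt → ℝ} (hs : IsOpen s)
    (sψ : SmoothOn2 s ψ) (hg : ContDiffOn ℝ (⊤ : ℕ∞) g S)
    (hS : ∀ t ∈ s, ∀ x, pd 2 (ψ t) x ∈ S) : SmoothOn2 s (density g ψ) := by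
  have sw := ((sψ.pd hs 2).pd hs 2).pd hs 2
  exact (SmoothOn2.comp hg (sψ.pd hs 2) hS).mul (sw.mul sw)

lemma mat_density {s S : Set ℝ} {g : ℝ → ℝ} {ψ : ℝ → Pt → ℝ} {v : Fin 3 → ℝ → Pt → ℝ} {t : ℝ}
    (hs : IsOpen s) (hψ : TransportEq s ψ v) (hdiv : DivFree s v) (sψ : SmoothOn2 s ψ)
    (sv : ∀ i, SmoothOn2 s (v i)) (hSo : IsOpen S) (hg : ContDiffOn ℝ (⊤ : ℕ∞) g S)
    (hode : ∀ y ∈ S, deriv g y * (1 + y) + 6 * g y = 1)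
    (hS : ∀ t ∈ s, ∀ x, pd 2 (ψ t) x ∈ S) (ht : t ∈ s) (x : Pt) :
    mat v (density g ψ) t x =
      ∑ h ∈ hIdx, hRem (fun x => g (pd 2 (ψ t) x)) (fun x => deriv g (pd 2 (ψ t) x))
        (ψ t) (v h t) h x - pd 2 (v 2 t) x * pd 2 (pd 2 (pd 2 (ψ t))) x ^ 2 := by
  have sa := sψ.pd hs 2
  have sw := (sa.pd hs 2).pd hs 2
  have e1 : mat v (density g ψ) t x = _ :=
    mat_mul hs (SmoothOn2.comp hg sa hS) (sw.mul sw) ht x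
  rw [e1, mat_mul hs sw sw ht, mat_comp hs sa ht x
    ((hg.contDiffAt (hSo.mem_nhds (hS t ht x))).differentiableAt (by simp)),
    hψ.mat_pd_pd_pd_eq hs sψ sv ht, hψ.mat_pd_eq hs sψ sv ht]
  have d1 := hdiv.pd (fun t ht i => (sv i).slice ht) 2
  have d2 := d1.pd (fun t ht i => ((sv i).pd hs 2).slice ht) 2
  have d1 := d1 t ht x
  have d2 := d2 t ht x
  have ode := hode _ (hS t ht x)
  have hI : hIdx = ({0, 1} : Finset (Fin 3)) := rfl
  rw [hI, Finset.sum_pair (by decide)]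
  simp only [Fin.sum_univ_three] at d1 d2 ⊢
  simp only [hRem]
  have e2 : pd 2 (pd 2 (v 2 t)) x = -(pd 0 (pd 2 (v 0 t)) x + pd 1 (pd 2 (v 1 t)) x) := by
    linarith
  have e3 : pd 2 (pd 2 (pd 2 (v 2 t))) x =
      -(pd 0 (pd 2 (pd 2 (v 0 t))) x + pd 1 (pd 2 (pd 2 (v 1 t))) x) := by
    linarith
  rw [e2, e3]
  linear_combination (-(pd 2 (v 2 t) x * pd 2 (pd 2 (pd 2 (ψ t))) x ^ 2)) * ode

lemma integral_cutoff_deriv {a b : ℝ} (hab : a ≤ b) {s : Set ℝ} (hs : IsOpen s)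
    (hsub : Icc a b ⊆ s) {H : ℝ → Pt → ℝ} (hH : SmoothOn2 s H) {χ : Pt → ℝ}
    (hχ : Continuous χ) (hc : HasCompactSupport χ) (ha : Integrable (H a)) (hb : Integrable (H b))
    (hχ1 : ∀ x, |χ x| ≤ 1) :
    IntervalIntegrable (fun t => ∫ x, χ x * deriv (fun τ => H τ x) t) volume a b ∧
    ∫ t in a..b, ∫ x, χ x * deriv (fun τ => H τ x) t = (∫ x, χ x * H b x) - ∫ x, χ x * H a x := by
  have hcont : ContinuousOn (fun q : ℝ × Pt => χ q.2 * deriv (fun τ => H τ q.2) q.1)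
      (Icc a b ×ˢ univ) :=
    (hχ.comp continuous_snd).continuousOn.mul
      ((hH.deriv hs).continuousOn.mono (prod_mono_left hsub))
  have hint : Integrable (Function.uncurry fun t x => χ x * deriv (fun τ => H τ x) t)
      ((volume.restrict (uIoc a b)).prod volume) := by
    have h1 : IntegrableOn (fun q : ℝ × Pt => χ q.2 * deriv (fun τ => H τ q.2) q.1)
        (Icc a b ×ˢ tsupport χ) :=
      (hcont.mono (prod_mono_right (subset_univ _))).integrableOn_compact
        (isCompact_Icc.prod hc.isCompact)
    have h2 : IntegrableOn (fun q : ℝ × Pt => χ q.2 * deriv (fun τ => H τ q.2) q.1)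
        (Icc a b ×ˢ univ) := by
      refine h1.of_forall_sdiff_eq_zero (measurableSet_Icc.prod MeasurableSet.univ) fun q hq => ?_
      have : q.2 ∉ tsupport χ := fun h => hq.2 ⟨hq.1.1, h⟩
      rw [image_eq_zero_of_notMem_tsupport this, zero_mul]
    have h3 : (volume.restrict (uIoc a b)).prod (volume : Measure Pt) =
        (volume : Measure (ℝ × Pt)).restrict (uIoc a b ×ˢ univ) := by
      rw [Measure.volume_eq_prod, ← Measure.prod_restrict, Measure.restrict_univ]
    rw [h3, uIoc_of_le hab]
    exact h2.mono_set (prod_mono_left Ioc_subset_Icc_self)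
  refine ⟨intervalIntegrable_iff.2 hint.integral_prod_left, ?_⟩
  have hi : ∀ {f : Pt → ℝ}, Integrable f → Integrable fun x => χ x * f x := fun hf =>
    hf.bdd_mul hχ.aestronglyMeasurable (ae_of_all _ hχ1)
  rw [intervalIntegral_integral_swap hint, ← integral_sub (hi hb) (hi ha)]
  congr 1
  funext x
  rw [intervalIntegral.integral_const_mul, ← mul_sub]
  congr 1
  refine intervalIntegral.integral_eq_sub_of_hasDerivAt (f := fun τ => H τ x)
    (fun t ht => ?_) ?_
  · rw [uIcc_of_le hab] at ht
    have := hH.hasDerivAt hs (hsub ht) x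
    rwa [← this.deriv] at this
  · refine ContinuousOn.intervalIntegrable ?_
    rw [uIcc_of_le hab]
    exact (hH.deriv hs).continuousOn.comp (g := fun q : ℝ × Pt => deriv (fun τ => H τ q.2) q.1)
      (f := fun t : ℝ => (t, x)) (by fun_prop) fun t ht => ⟨hsub ht, mem_univ _⟩

lemma integral_cutoff_transport {V : Fin 3 → Pt → ℝ} {H χ : Pt → ℝ}
    (hV : ∀ i, ContDiff ℝ (⊤ : ℕ∞) (V i)) (hdiv : ∀ x, ∑ i, pd i (V i) x = 0)
    (hH : ContDiff ℝ (⊤ : ℕ∞) H) (hχ : ContDiff ℝ (⊤ : ℕ∞) χ) (hc : HasCompactSupport χ) :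
    Integrable (fun x => χ x * ∑ i, V i x * pd i H x) ∧
    ∫ x, χ x * ∑ i, V i x * pd i H x = -∫ x, (∑ i, V i x * pd i χ x) * H x := by
  have top : (⊤ : ℕ∞) ≠ 0 := by simp
  have cpd : ∀ {f : Pt → ℝ}, ContDiff ℝ (⊤ : ℕ∞) f → ∀ i, Continuous (pd i f) := fun hf i =>
    (hf.continuous_fderiv (by simp)).clm_apply continuous_const
  have spd : ∀ i, HasCompactSupport (pd i χ) := fun i => hc.fderiv_apply ℝ _
  have dV : ∀ i, Differentiable ℝ (V i) := fun i => (hV i).differentiable (by simp)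
  have dH : Differentiable ℝ H := hH.differentiable (by simp)
  have dχ : Differentiable ℝ χ := hχ.differentiable (by simp)
  have i1 : ∀ i, Integrable fun x => χ x * V i x * pd i H x := fun i =>
    ((hχ.continuous.mul (hV i).continuous).mul (cpd hH i)).integrable_of_hasCompactSupport
      (hc.mul_right.mul_right)
  have i2 : ∀ i, Integrable fun x => pd i χ x * V i x * H x := fun i =>
    (((cpd hχ i).mul (hV i).continuous).mul hH.continuous).integrable_of_hasCompactSupport
      ((spd i).mul_right.mul_right)
  have i3 : ∀ i, Integrable fun x => χ x * pd i (V i) x * H x := fun i =>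
    ((hχ.continuous.mul (cpd (hV i) i)).mul hH.continuous).integrable_of_hasCompactSupport
      (hc.mul_right.mul_right)
  have i4 : ∀ i, Integrable fun x => χ x * V i x * H x := fun i =>
    ((hχ.continuous.mul (hV i).continuous).mul hH.continuous).integrable_of_hasCompactSupport
      (hc.mul_right.mul_right)
  have e : ∀ i, ∫ x, χ x * V i x * pd i H x =
      -((∫ x, pd i χ x * V i x * H x) + ∫ x, χ x * pd i (V i) x * H x) := fun i => by
    have i5 : Integrable fun x => (pd i χ x * V i x + χ x * pd i (V i) x) * H x :=
      ((i2 i).add (i3 i)).congr (ae_of_all _ fun x => by simp only [Pi.add_apply]; ring)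
    have := integral_mul_pd (f := fun x => χ x * V i x) (g := H) i (dχ.mul (dV i)) dH
      (by rw [pd_mul dχ (dV i)]; exact i5) (i1 i) (i4 i)
    rw [this, pd_mul dχ (dV i), ← integral_add (i2 i) (i3 i)]
    congr 2; funext x; ring
  have s1 : (fun x => χ x * ∑ i, V i x * pd i H x) = fun x => ∑ i, χ x * V i x * pd i H x := by
    funext x; rw [Finset.mul_sum]; exact Finset.sum_congr rfl fun i _ => by ring
  have s2 : (fun x => (∑ i, V i x * pd i χ x) * H x) = fun x => ∑ i, pd i χ x * V i x * H x := by
    funext x; rw [Finset.sum_mul]; exact Finset.sum_congr rfl fun i _ => by ring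
  have s3 : ∑ i, ∫ x, χ x * pd i (V i) x * H x = 0 := by
    rw [← integral_finsetSum _ fun i _ => i3 i]
    have : ∀ x, ∑ i, χ x * pd i (V i) x * H x = 0 := fun x => by
      rw [← Finset.sum_mul, ← Finset.mul_sum, hdiv x, mul_zero, zero_mul]
    simp [this]
  rw [s1, s2]
  refine ⟨integrable_finsetSum _ fun i _ => i1 i, ?_⟩
  rw [integral_finsetSum _ fun i _ => i1 i, integral_finsetSum _ fun i _ => i2 i,
    Finset.sum_congr rfl fun i _ => e i, Finset.sum_neg_distrib, Finset.sum_add_distrib, s3,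
    add_zero]

/-- Energy identity for the transport by a divergence-free field. -/
lemma integral_mat_eq {a b : ℝ} (hab : a ≤ b) {s : Set ℝ} (hs : IsOpen s)
    (hsub : Icc a b ⊆ s) {H : ℝ → Pt → ℝ} {v : Fin 3 → ℝ → Pt → ℝ} (hH : SmoothOn2 s H)
    (hv : ∀ i, SmoothOn2 s (v i)) (hdiv : DivFree s v) (hHi : ∀ t ∈ s, Integrable (H t))
    {M W : ℝ} (hM : ∀ t ∈ s, ∫ x, |H t x| ≤ M) (hW : ∀ t ∈ s, ∀ i x, |v i t x| ≤ W)
    (hG : ∀ t ∈ s, Integrable (mat v H t)) {k : ℝ → ℝ} (hk : IntervalIntegrable k volume a b)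
    (hGk : ∀ t ∈ s, ∫ x, |mat v H t x| ≤ k t) :
    IntervalIntegrable (fun t => ∫ x, mat v H t x) volume a b ∧
    ∫ t in a..b, ∫ x, mat v H t x = (∫ x, H b x) - ∫ x, H a x := by
  obtain ⟨χ, L, hL, hsm, hcs, h0, h1, hd, hlim⟩ := exists_cutoff
  have ha : a ∈ s := hsub (left_mem_Icc.2 hab)
  have hb : b ∈ s := hsub (right_mem_Icc.2 hab)
  have hχ1 : ∀ n x, |χ n x| ≤ 1 := fun n x => by rw [abs_of_nonneg (h0 n x)]; exact h1 n x
  have hI : uIoc a b ⊆ s := by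
    rw [uIoc_of_le hab]; exact Ioc_subset_Icc_self.trans hsub
  set e : ℕ → ℝ → ℝ := fun n t => ∫ x, χ n x * deriv (fun τ => H τ x) t with he
  have hfub := fun n => integral_cutoff_deriv hab hs hsub hH (hsm n).continuous (hcs n)
    (hHi a ha) (hHi b hb) (hχ1 n)
  have hpd : ∀ n i x, |pd i (χ n) x| ≤ L / (n + 1) := fun n i x => by
    refine ((fderiv ℝ (χ n) x).le_opNorm _).trans ?_
    simpa [Pi.norm_single] using hd n x
  have hW0 : 0 ≤ W := (abs_nonneg _).trans (hW a ha 0 0)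
  have hM0 : 0 ≤ M := (integral_nonneg fun _ => abs_nonneg _).trans (hM a ha)
  have herr : ∀ n, ∀ t ∈ s, |∫ x, (∑ i, v i t x * pd i (χ n) x) * H t x| ≤
      3 * W * M * (L / (n + 1)) := by
    intro n t ht
    have hb : ∀ x, ‖(∑ i, v i t x * pd i (χ n) x) * H t x‖ ≤ 3 * W * (L / (n + 1)) * |H t x| := by
      intro x
      rw [Real.norm_eq_abs, abs_mul]
      refine mul_le_mul_of_nonneg_right ((Finset.abs_sum_le_sum_abs _ _).trans ?_) (abs_nonneg _)
      have : ∀ i, |v i t x * pd i (χ n) x| ≤ W * (L / (n + 1)) := fun i => by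
        rw [abs_mul]; exact mul_le_mul (hW t ht i x) (hpd n i x) (abs_nonneg _) hW0
      rw [Fin.sum_univ_three]
      linarith [this 0, this 1, this 2]
    refine (norm_integral_le_of_norm_le ((hHi t ht).abs.const_mul _) (ae_of_all _ hb)).trans ?_
    rw [integral_const_mul]
    have : 0 ≤ 3 * W * (L / (n + 1)) := by positivity
    nlinarith [hM t ht]
  have hχi : ∀ n {f : Pt → ℝ}, Integrable f → Integrable fun x => χ n x * f x := fun n f hf =>
    hf.bdd_mul (hsm n).continuous.aestronglyMeasurable (ae_of_all _ (hχ1 n))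
  have hsplit : ∀ n, ∀ t ∈ s, e n t = (∫ x, χ n x * mat v H t x) +
      ∫ x, (∑ i, v i t x * pd i (χ n) x) * H t x := by
    intro n t ht
    obtain ⟨i1, e1⟩ := integral_cutoff_transport (fun i => (hv i).slice ht) (hdiv t ht)
      (hH.slice ht) (hsm n) (hcs n)
    rw [← neg_eq_iff_eq_neg.2 e1, ← sub_eq_add_neg, ← integral_sub (hχi n (hG t ht)) i1]
    simp only [he, mat]
    congr 1; funext x; ring
  have hlimχ : ∀ {f : Pt → ℝ}, Integrable f →
      Tendsto (fun n => ∫ x, χ n x * f x) atTop (nhds (∫ x, f x)) := fun {f} hf => by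
    refine tendsto_integral_of_dominated_convergence (fun x => |f x|)
      (fun n => (hχi n hf).aestronglyMeasurable) hf.abs (fun n => ae_of_all _ fun x => ?_)
      (ae_of_all _ fun x => ?_)
    · rw [Real.norm_eq_abs, abs_mul]
      exact mul_le_of_le_one_left (abs_nonneg _) (hχ1 n x)
    · simpa using (hlim x).mul_const (f x)
  have hzero : Tendsto (fun n : ℕ => 3 * W * M * (L / (n + 1))) atTop (nhds 0) := by
    have := ((tendsto_one_div_add_atTop_nhds_zero_nat (𝕜 := ℝ)).const_mul L).const_mul (3 * W * M)
    simpa [div_eq_mul_inv] using this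
  have hlime : ∀ t ∈ s, Tendsto (fun n => e n t) atTop (nhds (∫ x, mat v H t x)) := by
    intro t ht
    have := (hlimχ (hG t ht)).add (squeeze_zero_norm (fun n => herr n t ht) hzero)
    rw [add_zero] at this
    exact this.congr fun n => (hsplit n t ht).symm
  have hbound : ∀ n, ∀ t ∈ s, ‖e n t‖ ≤ k t + 3 * W * M * L := by
    intro n t ht
    rw [hsplit n t ht]
    refine (norm_add_le _ _).trans (add_le_add ?_ ((herr n t ht).trans ?_))
    · refine (norm_integral_le_of_norm_le (hG t ht).abs (ae_of_all _ fun x => ?_)).trans (hGk t ht)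
      rw [Real.norm_eq_abs, abs_mul]
      exact mul_le_of_le_one_left (abs_nonneg _) (hχ1 n x)
    · have : L / (n + 1) ≤ L := div_le_self hL (by linarith [Nat.cast_nonneg (α := ℝ) n])
      gcongr
  have hk' : IntervalIntegrable (fun t => k t + 3 * W * M * L) volume a b :=
    hk.add intervalIntegrable_const
  have hmeas : ∀ n, AEStronglyMeasurable (e n) (volume.restrict (uIoc a b)) := fun n =>
    (hfub n).1.aestronglyMeasurable_restrict_uIoc
  have hae : ∀ᵐ t ∂volume.restrict (uIoc a b), t ∈ s :=
    (ae_restrict_mem measurableSet_uIoc).mono fun t ht => hI ht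
  have hlimm := intervalIntegral.tendsto_integral_filter_of_dominated_convergence (μ := volume)
    (F := e) (f := fun t => ∫ x, mat v H t x) (l := atTop) (a := a) (b := b) _
    (Eventually.of_forall hmeas)
    (Eventually.of_forall fun n => ae_of_all _ fun t ht => hbound n t (hI ht)) hk'
    (ae_of_all _ fun t ht => hlime t (hI ht))
  refine ⟨?_, tendsto_nhds_unique hlimm ?_⟩
  · rw [intervalIntegrable_iff] at hk' ⊢
    refine hk'.mono' (aestronglyMeasurable_of_tendsto_ae atTop hmeas
      (hae.mono fun t ht => hlime t ht)) (hae.mono fun t ht => ?_)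
    exact le_of_tendsto (hlime t ht).norm (Eventually.of_forall fun n => hbound n t ht)
  · exact ((hlimχ (hHi b hb)).sub (hlimχ (hHi a ha))).congr fun n => ((hfub n).2).symm

lemma gradHSq_nonneg (k : ℕ) (f : Pt → ℝ) : 0 ≤ gradHSq k f :=
  Finset.sum_nonneg fun _ _ => hSq_nonneg _ _

lemma gradHHSq_nonneg (k : ℕ) (f : Pt → ℝ) : 0 ≤ gradHHSq k f :=
  Finset.sum_nonneg fun _ _ => Finset.sum_nonneg fun _ _ => hSq_nonneg _ _

lemma gradVecHSq_nonneg (k : ℕ) (v : Fin 3 → Pt → ℝ) : 0 ≤ gradVecHSq k v :=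
  Finset.sum_nonneg fun _ _ => gradHSq_nonneg _ _

lemma l2T_sqrt_sq {T : ℝ} (hT : 0 ≤ T) {g : ℝ → ℝ} (hg : ∀ t, 0 ≤ g t) :
    (l2T T fun t => √(g t)) ^ 2 = ∫ t in (0 : ℝ)..T, g t := by
  simp only [l2T, Real.sq_sqrt (hg _)]
  exact Real.sq_sqrt (intervalIntegral.integral_nonneg hT fun t _ => hg t)

lemma le_supT_sqrt_sq {T : ℝ} {g : ℝ → ℝ}
    (hb : BddAbove ((fun t => √(g t)) '' Icc 0 T)) {t : ℝ} (ht : t ∈ Icc 0 T) :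
    g t ≤ (supT T fun t => √(g t)) ^ 2 := by
  have h1 : √(g t) ≤ supT T fun t => √(g t) := le_csSup hb (mem_image_of_mem _ ht)
  exact (Real.sqrt_le_left ((Real.sqrt_nonneg _).trans h1)).1 h1

/-- The bounds encoded in `B_T`. -/
lemma FiniteClass.bounds {T : ℝ} (hT : 0 ≤ T) {ψ : ℝ → Pt → ℝ} {v : Fin 3 → ℝ → Pt → ℝ}
    (h : FiniteClass T ψ v) :
    (∀ t ∈ Icc 0 T, vecHSq 2 (fun j => v j t) ≤ BT T ψ v ^ 2) ∧
    (∀ t ∈ Icc 0 T, gradHSq 2 (ψ t) ≤ BT T ψ v ^ 2) ∧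
    IntervalIntegrable (fun t => gradVecHSq 2 (fun j => v j t) + gradHHSq 1 (ψ t)) volume 0 T ∧
    ∫ t in (0 : ℝ)..T, (gradVecHSq 2 (fun j => v j t) + gradHHSq 1 (ψ t)) ≤ BT T ψ v ^ 2 := by
  obtain ⟨h1, h2, h3, h4⟩ := h
  have hB : BT T ψ v ^ 2 = BTsq T ψ v := Real.sq_sqrt (by rw [BTsq]; positivity)
  have e3 := l2T_sqrt_sq hT fun t => gradVecHSq_nonneg 2 fun j => v j t
  have e4 := l2T_sqrt_sq hT fun t => gradHHSq_nonneg 1 (ψ t)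
  have s1 := sq_nonneg (supT T fun t => √(vecHSq 2 fun j => v j t))
  have s2 := sq_nonneg (supT T fun t => √(gradHSq 2 (ψ t)))
  have s3 := sq_nonneg (l2T T fun t => √(gradVecHSq 2 fun j => v j t))
  have s4 := sq_nonneg (l2T T fun t => √(gradHHSq 1 (ψ t)))
  rw [hB, BTsq]
  refine ⟨fun t ht => ?_, fun t ht => ?_, h3.add h4, ?_⟩
  · have := le_supT_sqrt_sq h1 ht
    linarith
  · have := le_supT_sqrt_sq h2 ht
    linarith
  · rw [intervalIntegral.integral_add h3 h4, ← e3, ← e4]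
    linarith

lemma abs_intervalIntegral_le_of_forall_Ioo {T M : ℝ} (hT : 0 < T) {J : ℝ → ℝ}
    (hJ : IntervalIntegrable J volume 0 T)
    (h : ∀ a b, 0 < a → a < b → b < T → |∫ t in a..b, J t| ≤ M) :
    |∫ t in (0 : ℝ)..T, J t| ≤ M := by
  set F : ℝ → ℝ := fun b => ∫ t in (0 : ℝ)..b, J t with hF
  have hc : ContinuousOn F (Icc 0 T) := by
    have := intervalIntegral.continuousOn_primitive_interval' hJ (left_mem_uIcc)
    rwa [uIcc_of_le hT.le] at this
  have hsub : ∀ a b, 0 < a → a < b → b < T → |F b - F a| ≤ M := fun a b ha hab hb => by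
    have i1 : ∀ c, 0 ≤ c → c ≤ T → IntervalIntegrable J volume 0 c := fun c h0 h1 =>
      hJ.mono_set (by rw [uIcc_of_le h0, uIcc_of_le hT.le]; exact Icc_subset_Icc_right h1)
    rw [hF, intervalIntegral.integral_interval_sub_left (i1 b (ha.trans hab).le hb.le)
      (i1 a ha.le (hab.trans hb).le)]
    exact h a b ha hab hb
  have step : ∀ a, 0 < a → a < T → |F T - F a| ≤ M := fun a ha haT => by
    have ht : Tendsto F (nhdsWithin T (Ioo a T)) (nhds (F T)) :=
      (hc T ⟨hT.le, le_rfl⟩).mono fun b hb => ⟨(ha.trans hb.1).le, hb.2.le⟩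
    rw [nhdsWithin_Ioo_eq_nhdsLT haT] at ht
    refine le_of_tendsto ((ht.sub_const (F a)).abs) ?_
    filter_upwards [Ioo_mem_nhdsLT haT] with b hb using hsub a b ha hb.1 hb.2
  have ht : Tendsto F (nhdsWithin 0 (Ioo 0 T)) (nhds (F 0)) :=
    (hc 0 ⟨le_rfl, hT.le⟩).mono Ioo_subset_Icc_self
  rw [nhdsWithin_Ioo_eq_nhdsGT hT] at ht
  have hF0 : F 0 = 0 := intervalIntegral.integral_same
  have : |F T - F 0| ≤ M := by
    refine le_of_tendsto ((tendsto_const_nhds.sub ht).abs) ?_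
    filter_upwards [Ioo_mem_nhdsGT hT] with a ha using step a ha.1 ha.2
  rwa [hF0, sub_zero] at this

/-- The estimate for a given primitive `g` of the weight. -/
lemma exists_weighted_estimate : ∃ C : ℝ, 0 < C ∧ ∀ T : ℝ, 0 < T →
    ∀ (ψ : ℝ → Pt → ℝ) (v : Fin 3 → ℝ → Pt → ℝ),
      SmoothOn2 (Icc 0 T) ψ → (∀ j, SmoothOn2 (Icc 0 T) (v j)) →
      (∀ t ∈ Icc (0 : ℝ) T, IsSchwartz (ψ t) ∧ ∀ j, IsSchwartz (v j t)) →
      DivFree (Icc 0 T) v → TransportEq (Icc 0 T) ψ v → FiniteClass T ψ v →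
      ∀ B, B = BT T ψ v → ∀ (g : ℝ → ℝ) (S : Set ℝ) (Φ K : ℝ), IsOpen S →
      ContDiffOn ℝ (⊤ : ℕ∞) g S → (∀ y ∈ S, deriv g y * (1 + y) + 6 * g y = 1) →
      (∀ y, |y| ≤ C * B → y ∈ S ∧ |g y| ≤ Φ ∧ |deriv g y| ≤ K) →
      |∫ t in (0 : ℝ)..T, ∫ x, pd 2 (v 2 t) x * (pd 2 (pd 2 (pd 2 (ψ t))) x) ^ 2| ≤
        2 * (Φ * B ^ 2) + 2 * C * (B ^ 2 *
          (K * B ^ 2 + Φ * B + (1 + 5 * Φ) * B + Φ * (1 + C * B))) := by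
  obtain ⟨C, hC, H1, H2⟩ := exists_fixed_time_bounds
  obtain ⟨c, hc, Hc⟩ := exists_abs_le_gradient
  refine ⟨C, hC, fun T hT ψ v sψ sv hS hdiv htr hfin B hB g S Φ K hSo hg hode hgS => ?_⟩
  obtain ⟨bv, bψ, iQ, bQ⟩ := hfin.bounds hT.le
  rw [← hB] at bv bψ bQ
  have hB0 : 0 ≤ B := hB ▸ Real.sqrt_nonneg _
  set Q : ℝ → ℝ := fun t => gradVecHSq 2 (fun j => v j t) + gradHHSq 1 (ψ t) with hQ
  have hQ0 : ∀ t, 0 ≤ Q t := fun t => add_nonneg (gradVecHSq_nonneg _ _) (gradHHSq_nonneg _ _)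
  have hsub : Ioo 0 T ⊆ Icc 0 T := Ioo_subset_Icc_self
  have sψ' : SmoothOn2 (Ioo 0 T) ψ := ContDiffOn.mono sψ (prod_mono_left hsub)
  have sv' : ∀ i, SmoothOn2 (Ioo 0 T) (v i) := fun i =>
    ContDiffOn.mono (sv i) (prod_mono_left hsub)
  have hdiv' : DivFree (Ioo 0 T) v := fun t ht => hdiv t (hsub ht)
  have htr' : TransportEq (Ioo 0 T) ψ v := fun t ht => htr t (hsub ht)
  have Sψ : ∀ t ∈ Ioo 0 T, IsSchwartz (ψ t) := fun t ht => (hS t (hsub ht)).1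
  have Sv : ∀ t ∈ Ioo 0 T, ∀ j, IsSchwartz (v j t) := fun t ht => (hS t (hsub ht)).2
  have ha : ∀ t ∈ Ioo 0 T, ∀ x, |pd 2 (ψ t) x| ≤ C * B := fun t ht =>
    H1 _ (Sψ t ht) B hB0 (bψ t (hsub ht))
  have haS : ∀ t ∈ Ioo 0 T, ∀ x, pd 2 (ψ t) x ∈ S := fun t ht x => (hgS _ (ha t ht x)).1
  have hΦ0 : 0 ≤ Φ := (abs_nonneg _).trans (hgS 0 (by rw [abs_zero]; positivity)).2.1
  have hK0 : 0 ≤ K := (abs_nonneg _).trans (hgS 0 (by rw [abs_zero]; positivity)).2.2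
  set R : Fin 3 → ℝ → Pt → ℝ := fun h t => hRem (fun x => g (pd 2 (ψ t) x))
    (fun x => deriv g (pd 2 (ψ t) x)) (ψ t) (v h t) h with hR
  set Θ : ℝ := K * B ^ 2 + Φ * B + (1 + 5 * Φ) * B + Φ * (1 + C * B) with hΘ
  have hQV : ∀ t j, gradHSq 2 (v j t) ≤ √(Q t) ^ 2 := fun t j => by
    rw [Real.sq_sqrt (hQ0 t)]
    have := Finset.single_le_sum (f := fun j => gradHSq 2 (v j t))
      (fun _ _ => gradHSq_nonneg _ _) (Finset.mem_univ j)
    have h' : gradHSq 2 (v j t) ≤ gradVecHSq 2 fun j => v j t := this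
    linarith [gradHHSq_nonneg 1 (ψ t)]
  -- the horizontal remainders
  have hrem : ∀ t ∈ Ioo 0 T, ∀ h ∈ hIdx, Integrable (R h t) ∧ |∫ x, R h t x| ≤ C * (Q t * Θ) ∧
      ∫ x, |R h t x| ≤ C * (Q t * (K * B ^ 2 + Φ * B) + Φ * (1 + C * B) * B * √(Q t)
        + Φ * B ^ 2 * √(Q t)) := by
    intro t ht h hh
    have Sa := (Sψ t ht).pd 2
    have gd : ∀ x, DifferentiableAt ℝ g (pd 2 (ψ t) x) := fun x =>
      (hg.contDiffAt (hSo.mem_nhds (haS t ht x))).differentiableAt (by simp)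
    have gc : Continuous fun x => deriv g (pd 2 (ψ t) x) :=
      (hg.continuousOn_deriv_of_isOpen hSo (by simp)).comp_continuous Sa.continuous (haS t ht)
    have := H2 (ψ t) (v h t) (Sψ t ht) (Sv t ht h) h hh B (√(Q t)) hB0 (Real.sqrt_nonneg _)
      (bψ t (hsub ht)) (hQV t h)
      (by rw [Real.sq_sqrt (hQ0 t)]; exact le_add_of_nonneg_left (gradVecHSq_nonneg _ _))
      (fun x => g (pd 2 (ψ t) x)) (fun x => deriv g (pd 2 (ψ t) x)) Φ K (Φ * (1 + C * B))
      (1 + 5 * Φ) (fun x => (gd x).comp x (Sa.differentiable x)) gc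
      (fun i x => pd_comp (gd x) Sa.differentiable i) (fun x => hode _ (haS t ht x))
      (fun x => (hgS _ (ha t ht x)).2.1) (fun x => (hgS _ (ha t ht x)).2.2)
      (fun x => by
        rw [abs_mul]
        refine mul_le_mul (hgS _ (ha t ht x)).2.1 ((abs_add_le _ _).trans ?_) (abs_nonneg _) hΦ0
        rw [abs_one]
        linarith [ha t ht x])
      (fun x => by
        have := abs_le.1 (hgS _ (ha t ht x)).2.1
        rw [abs_le]
        constructor <;> linarith [this.1, this.2])
    rw [Real.sq_sqrt (hQ0 t)] at this
    exact this
  -- the term to be estimated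
  set w : ℝ → Pt → ℝ := fun t => pd 2 (pd 2 (pd 2 (ψ t))) with hw
  have Sw : ∀ t ∈ Ioo 0 T, IsSchwartz (w t) := fun t ht => (((Sψ t ht).pd 2).pd 2).pd 2
  have bw : ∀ t ∈ Ioo 0 T, n2 (w t) ≤ B := fun t ht => n2_le_of_sq hB0 <|
    (l2Sq_pd_pd_le_hSq ((Sψ t ht).pd 2).1 2 2).trans
      ((hSq_pd_le_gradHSq 2 (ψ t) 2).trans (bψ t (hsub ht)))
  have hJ : ∀ t ∈ Ioo 0 T, Integrable (fun x => pd 2 (v 2 t) x * w t x ^ 2) ∧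
      ∫ x, |pd 2 (v 2 t) x * w t x ^ 2| ≤ C * √(Q t) * (B * B) := fun t ht => by
    have := integrable_and_abs_integral_le ((Sv t ht 2).pd 2).continuous
      (H1 _ (Sv t ht 2) _ (Real.sqrt_nonneg _) (hQV t 2)) ((Sw t ht).memLp 2)
      ((Sw t ht).memLp 2) (bw t ht) (bw t ht)
    simpa only [mul_assoc, ← sq] using this
  have hH : ∀ t ∈ Ioo 0 T, Integrable (density g ψ t) ∧ ∫ x, |density g ψ t x| ≤ Φ * (B * B) :=
    fun t ht => by
    have := integrable_and_abs_integral_le (m := fun x => g (pd 2 (ψ t) x))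
      (hg.continuousOn.comp_continuous ((Sψ t ht).pd 2).continuous (haS t ht))
      (fun x => (hgS _ (ha t ht x)).2.1) ((Sw t ht).memLp 2)
      ((Sw t ht).memLp 2) (bw t ht) (bw t ht)
    simp only [mul_assoc] at this
    exact this
  have hmat : ∀ t ∈ Ioo 0 T, mat v (density g ψ) t =
      fun x => (∑ h ∈ hIdx, R h t x) - pd 2 (v 2 t) x * w t x ^ 2 := fun t ht =>
    funext fun x => mat_density isOpen_Ioo htr' hdiv' sψ' sv' hSo hg hode haS ht x
  have hsumi : ∀ t ∈ Ioo 0 T, Integrable fun x => ∑ h ∈ hIdx, R h t x := fun t ht =>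
    integrable_finsetSum _ fun h hh => (hrem t ht h hh).1
  have hcard : hIdx.card = 2 := rfl
  have hG : ∀ t ∈ Ioo 0 T, Integrable (mat v (density g ψ) t) := fun t ht => by
    rw [hmat t ht]; exact (hsumi t ht).sub (hJ t ht).1
  set k : ℝ → ℝ := fun t => 2 * (C * (Q t * (K * B ^ 2 + Φ * B) +
    Φ * (1 + C * B) * B * (1 + Q t) + Φ * B ^ 2 * (1 + Q t))) + C * (1 + Q t) * (B * B) with hk
  have hsq : ∀ t, √(Q t) ≤ 1 + Q t := fun t =>
    Real.sqrt_le_iff.2 ⟨by linarith [hQ0 t], by nlinarith [hQ0 t]⟩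
  have hGk : ∀ t ∈ Ioo 0 T, ∫ x, |mat v (density g ψ) t x| ≤ k t := by
    intro t ht
    have h1 : ∀ x, |mat v (density g ψ) t x| ≤
        (∑ h ∈ hIdx, |R h t x|) + |pd 2 (v 2 t) x * w t x ^ 2| := fun x => by
      rw [hmat t ht]
      exact (abs_sub _ _).trans (add_le_add_left (Finset.abs_sum_le_sum_abs _ _) _)
    have i1 : Integrable fun x => ∑ h ∈ hIdx, |R h t x| :=
      integrable_finsetSum _ fun h hh => (hrem t ht h hh).1.abs
    refine (integral_mono (hG t ht).abs (i1.add (hJ t ht).1.abs) h1).trans ?_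
    refine (integral_add i1 (hJ t ht).1.abs).le.trans (add_le_add ?_ ((hJ t ht).2.trans ?_))
    · rw [integral_finsetSum _ fun h hh => (hrem t ht h hh).1.abs]
      refine (Finset.sum_le_card_nsmul _ _ _ fun h hh => (hrem t ht h hh).2.2).trans ?_
      rw [hcard, nsmul_eq_mul]
      push_cast
      have := hsq t
      gcongr
    · have := hsq t
      gcongr
  by_cases hJi : IntervalIntegrable (fun t => ∫ x, pd 2 (v 2 t) x * w t x ^ 2) volume 0 T
  swap
  · rw [intervalIntegral.integral_undef hJi, abs_zero]
    positivity
  refine abs_intervalIntegral_le_of_forall_Ioo hT hJi fun a b ha0 hab hbT => ?_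
  have hIcc : Icc a b ⊆ Ioo 0 T := Icc_subset_Ioo ha0 hbT
  have hsubI : uIcc a b ⊆ uIcc 0 T := by
    rw [uIcc_of_le hab.le, uIcc_of_le hT.le]; exact hIcc.trans hsub
  have iQab : IntervalIntegrable Q volume a b := iQ.mono_set hsubI
  have ik : IntervalIntegrable k volume a b := by
    have h1 : IntervalIntegrable (fun t => 1 + Q t) volume a b := intervalIntegrable_const.add iQab
    exact (((((iQab.mul_const _).add (h1.const_mul _)).add (h1.const_mul _)).const_mul C).const_mul
      2).add ((h1.const_mul C).mul_const _)
  obtain ⟨iG, eG⟩ := integral_mat_eq (W := c * √(12 * B ^ 2)) hab.le isOpen_Ioo hIcc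
    (smoothOn2_density isOpen_Ioo sψ' hg haS) sv' hdiv' (fun t ht => (hH t ht).1)
    (fun t ht => (hH t ht).2)
    (fun t ht i x => by
      refine (Hc _ (Sv t ht i) x).trans (mul_le_mul_of_nonneg_left (Real.sqrt_le_sqrt ?_) hc.le)
      have h1 : hSq 2 (v i t) ≤ B ^ 2 :=
        (Finset.single_le_sum (f := fun j => hSq 2 (v j t)) (fun _ _ => hSq_nonneg _ _)
          (Finset.mem_univ i)).trans (bv t (hsub ht))
      rw [gradHSq, Fin.sum_univ_three]
      linarith [hSq_one_pd_le (Sv t ht i).1 0, hSq_one_pd_le (Sv t ht i).1 1,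
        hSq_one_pd_le (Sv t ht i).1 2]) hG ik hGk
  have hJab := hJi.mono_set hsubI
  have eR : ∀ t ∈ Ioo 0 T, (∫ x, mat v (density g ψ) t x) +
      ∫ x, pd 2 (v 2 t) x * w t x ^ 2 = ∑ h ∈ hIdx, ∫ x, R h t x := fun t ht => by
    rw [hmat t ht, integral_sub (hsumi t ht) (hJ t ht).1, sub_add_cancel,
      integral_finsetSum _ fun h hh => (hrem t ht h hh).1]
  have bR : |∫ t in a..b, ((∫ x, mat v (density g ψ) t x) +
      ∫ x, pd 2 (v 2 t) x * w t x ^ 2)| ≤ 2 * C * (B ^ 2 * Θ) := by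
    have hΘ0 : 0 ≤ Θ := by rw [hΘ]; positivity
    have h1 : ‖∫ t in a..b, ((∫ x, mat v (density g ψ) t x) +
        ∫ x, pd 2 (v 2 t) x * w t x ^ 2)‖ ≤ ∫ t in a..b, 2 * C * Θ * Q t := by
      refine intervalIntegral.norm_integral_le_of_norm_le hab.le (ae_of_all _ fun t ht => ?_)
        (iQab.const_mul _)
      have ht' : t ∈ Ioo 0 T := hIcc (Ioc_subset_Icc_self ht)
      rw [eR t ht']
      refine (Finset.abs_sum_le_sum_abs _ _).trans ((Finset.sum_le_card_nsmul _ _ _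
        fun h hh => (hrem t ht' h hh).2.1).trans ?_)
      rw [hcard, nsmul_eq_mul]
      push_cast
      linarith
    refine h1.trans ?_
    rw [intervalIntegral.integral_const_mul]
    have h2 : ∫ t in a..b, Q t ≤ B ^ 2 :=
      (intervalIntegral.integral_mono_interval ha0.le hab.le hbT.le
        (ae_of_all _ hQ0) iQ).trans bQ
    have : 0 ≤ 2 * C * Θ := by positivity
    nlinarith
  rw [intervalIntegral.integral_add iG hJab, eG] at bR
  have b1 := abs_le.1 (abs_integral_le_integral_abs.trans
    (hH a (hIcc (left_mem_Icc.2 hab.le))).2)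
  have b2 := abs_le.1 (abs_integral_le_integral_abs.trans
    (hH b (hIcc (right_mem_Icc.2 hab.le))).2)
  have b3 := abs_le.1 bR
  rw [abs_le]
  constructor <;> nlinarith [b1.1, b1.2, b2.1, b2.2, b3.1, b3.2]

lemma hasDerivAt_weight {y : ℝ} (hy : 0 < 1 + y) :
    HasDerivAt (fun y : ℝ => (1 - ((1 + y) ^ 6)⁻¹) / 6) (((1 + y) ^ 7)⁻¹) y := by
  have h1 : HasDerivAt (fun y : ℝ => (1 + y) ^ 6) (6 * (1 + y) ^ 5) y := by
    simpa using ((hasDerivAt_id y).const_add 1).fun_pow 6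
  have h2 := (((h1.fun_inv (by positivity)).const_sub 1).div_const 6)
  refine h2.congr_deriv ?_
  field_simp

lemma contDiffOn_weight :
    ContDiffOn ℝ (⊤ : ℕ∞) (fun y : ℝ => (1 - ((1 + y) ^ 6)⁻¹) / 6) (Ioi (-1)) := by
  refine ((contDiffOn_const.sub (ContDiffOn.inv ?_ fun y hy => ?_))).div_const 6
  · fun_prop
  · have : 0 < 1 + y := by linarith [mem_Ioi.1 hy]
    positivity

lemma weight_bounds {y : ℝ} (hy : |y| ≤ 1 / 2) :
    |(1 - ((1 + y) ^ 6)⁻¹) / 6| ≤ 128 * |y| ∧ |((1 + y) ^ 7)⁻¹| ≤ 128 := by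
  have hy' := abs_le.1 hy
  have hu : 1 / 2 ≤ 1 + y := by linarith
  have h6 : ((1 + y) ^ 6)⁻¹ ≤ 64 := by
    have : (1 / 2 : ℝ) ^ 6 ≤ (1 + y) ^ 6 := pow_le_pow_left₀ (by norm_num) hu 6
    exact (inv_anti₀ (by norm_num) this).trans (by norm_num)
  have h7 : ((1 + y) ^ 7)⁻¹ ≤ 128 := by
    have : (1 / 2 : ℝ) ^ 7 ≤ (1 + y) ^ 7 := pow_le_pow_left₀ (by norm_num) hu 7
    exact (inv_anti₀ (by norm_num) this).trans (by norm_num)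
  have hp : 0 < 1 + y := by linarith
  refine ⟨?_, by rwa [abs_of_nonneg (by positivity)]⟩
  have hseg : ∀ z ∈ Icc (-(1 / 2) : ℝ) (1 / 2),
      ‖((1 + z) ^ 7)⁻¹‖ ≤ 128 := fun z hz => by
    have hz1 : 1 / 2 ≤ 1 + z := by linarith [hz.1]
    have : (1 / 2 : ℝ) ^ 7 ≤ (1 + z) ^ 7 := pow_le_pow_left₀ (by norm_num) hz1 7
    have hz2 : 0 < 1 + z := by linarith
    rw [Real.norm_of_nonneg (by positivity)]
    exact (inv_anti₀ (by norm_num) this).trans (by norm_num)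
  have := (convex_Icc (-(1 / 2) : ℝ) (1 / 2)).norm_image_sub_le_of_norm_hasDerivWithin_le
    (fun z hz => (hasDerivAt_weight (y := z) (by linarith [hz.1])).hasDerivWithinAt) hseg
    (x := 0) (y := y) ⟨by norm_num, by norm_num⟩ ⟨by linarith [hy'.1], hy'.2⟩
  simpa [abs_div] using this

/-- Lemma 2.5: `|∫₀^T∫ ∂₃v₃ (∂₃³ψ)²| ≤ C B_T³ (1 + B_T²)`. -/
theorem stmt_10 :
    ∃ C : ℝ, 0 < C ∧ ∀ T : ℝ, 0 < T → ∀ (ψ : ℝ → Pt → ℝ) (v : Fin 3 → ℝ → Pt → ℝ),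
      SmoothOn2 (Icc 0 T) ψ → (∀ j, SmoothOn2 (Icc 0 T) (v j)) →
      (∀ t ∈ Icc (0:ℝ) T, IsSchwartz (ψ t) ∧ ∀ j, IsSchwartz (v j t)) →
      DivFree (Icc 0 T) v → TransportEq (Icc 0 T) ψ v → FiniteClass T ψ v →
      |∫ t in (0:ℝ)..T, ∫ x : Pt, pd 2 (v 2 t) x * (pd 2 (pd 2 (pd 2 (ψ t))) x) ^ 2| ≤
        C * BT T ψ v ^ 3 * (1 + BT T ψ v ^ 2) := by
  obtain ⟨C, hC, H⟩ := exists_weighted_estimate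
  refine ⟨2 * (300 * C + 2000 * C ^ 2 + 300 * C ^ 3), by positivity,
    fun T hT ψ v sψ sv hS hdiv htr hfin => ?_⟩
  set B := BT T ψ v with hB
  have hB0 : 0 ≤ B := Real.sqrt_nonneg _
  suffices h : |∫ t in (0:ℝ)..T, ∫ x : Pt, pd 2 (v 2 t) x * (pd 2 (pd 2 (pd 2 (ψ t))) x) ^ 2| ≤
      (300 * C + 2000 * C ^ 2 + 300 * C ^ 3) * (B ^ 3 * (1 + B)) by
    refine h.trans ?_
    have h1 : B ^ 3 * (1 + B) ≤ 2 * (B ^ 3 * (1 + B ^ 2)) := by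
      have : 1 + B ≤ 2 * (1 + B ^ 2) := by nlinarith [sq_nonneg (B - 1)]
      nlinarith [pow_nonneg hB0 3]
    have h2 : 0 ≤ 300 * C + 2000 * C ^ 2 + 300 * C ^ 3 := by positivity
    nlinarith [mul_le_mul_of_nonneg_left h1 h2]
  have K := H T hT ψ v sψ sv hS hdiv htr hfin B hB
  rcases le_or_gt (C * B) (1 / 2) with hs | hl
  · refine (K _ (Ioi (-1)) (128 * (C * B)) 128 isOpen_Ioi contDiffOn_weight (fun y hy => ?_)
      fun y hy => ?_).trans ?_
    · have hp : 0 < 1 + y := by linarith [mem_Ioi.1 hy]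
      rw [(hasDerivAt_weight hp).deriv]
      field_simp
      ring
    · have hb := weight_bounds (hy.trans hs)
      have hp : 0 < 1 + y := by linarith [(abs_le.1 (hy.trans hs)).1]
      refine ⟨by rw [mem_Ioi]; linarith, hb.1.trans (by linarith), ?_⟩
      rw [(hasDerivAt_weight hp).deriv]
      exact hb.2
    · rw [← sub_nonneg]
      have : 0 ≤ 42 * (C * B ^ 3) + 44 * (C * B ^ 4) + 1744 * (C ^ 2 * B ^ 3) +
        464 * (C ^ 2 * B ^ 4) + 300 * (C ^ 3 * B ^ 3) + 44 * (C ^ 3 * B ^ 4) := by positivity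
      refine this.trans_eq ?_
      ring
  · refine (K (fun _ => 1 / 6) univ (1 / 6) 0 isOpen_univ contDiffOn_const (fun y _ => ?_)
      fun y _ => ⟨mem_univ _, ?_, ?_⟩).trans ?_
    · simp
    · rw [abs_of_pos (by norm_num)]
    · simp
    · have h2 : B ^ 2 ≤ 2 * (C * B ^ 3) := by nlinarith [sq_nonneg B]
      have h3 : C * B ^ 2 ≤ C * (2 * (C * B ^ 3)) := mul_le_mul_of_nonneg_left h2 hC.le
      have p1 : 0 ≤ C * B ^ 3 := by positivity
      have p2 : 0 ≤ C ^ 2 * B ^ 3 := by positivity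
      have p3 : 0 ≤ C ^ 3 * B ^ 3 := by positivity
      have p4 : 0 ≤ (300 * C + 2000 * C ^ 2 + 300 * C ^ 3) * B ^ 4 := by positivity
      nlinarith

end
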